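/- arXiv:2602.13755 — 2 statements merged into one kernel-verified Lean document; each statement's English description precedes it below -/
import Mathlib

section
/- Let D ⊂ ℝⁿ (n ≥ 2) be a domain, a, b ∈ ℝⁿ with a ≠ b, and let Q : ℝⁿ → [0,∞] be locally integrable on ℝⁿ. Then the family 𝔉_{Q,a,b}(D) of all open discrete mappings f : D → ℝⁿ \ {a, b} satisfying the inverse Poletsky inequality with majorant Q at every point y₀ ∈ ℝⁿ is equicontinuous (with respect to the chordal metric on the target) at each point x₀ ∈ D. -/
open MeasureTheory Metric Set Filter Topology
open scoped ENNReal NNReal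

noncomputable section
open scoped Classical

/-- The (clamped) total-variation function of `γ` on `[a, b]`. -/
def varFun (n : ℕ) (γ : ℝ → EuclideanSpace ℝ (Fin n)) (a b t : ℝ) : ℝ :=
  (eVariationOn γ (Set.Icc a (max a (min t b)))).toReal

/-- The arc-length (Lebesgue–Stieltjes) integral `∫_γ ρ ds` of a Borel function
`ρ : ℝⁿ → [0,∞]` along the path `γ : [a, b] → ℝⁿ`, defined via the Lebesgue–Stieltjes
measure associated to the arc-length (variation) function of `γ`.  It is `∞` when `γ`
is not rectifiable. -/
def arcIntegral (n : ℕ) (ρ : EuclideanSpace ℝ (Fin n) → ℝ≥0∞)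
    (γ : ℝ → EuclideanSpace ℝ (Fin n)) (a b : ℝ) : ℝ≥0∞ :=
  if h : BoundedVariationOn γ (Set.Icc a b) ∧ Monotone (varFun n γ a b) then
    ∫⁻ t in Set.Icc a b, ρ (γ t) ∂h.2.stieltjesFunction.measure
  else ∞

/-- A (continuous) path in `ℝⁿ` defined on a compact interval `[a, b]`. -/
structure PathOn (n : ℕ) where
  a : ℝ
  b : ℝ
  hab : a ≤ b
  toFun : ℝ → EuclideanSpace ℝ (Fin n)
  cont : ContinuousOn toFun (Set.Icc a b)

/-- A Borel function `ρ : ℝⁿ → [0,∞]` is admissible for a family `Γ` of paths if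
`∫_γ ρ ds ≥ 1` for every (locally rectifiable) path `γ ∈ Γ`. -/
def IsAdmissibleFor (n : ℕ) (ρ : EuclideanSpace ℝ (Fin n) → ℝ≥0∞)
    (Γ : Set (PathOn n)) : Prop :=
  Measurable ρ ∧ ∀ γ ∈ Γ, 1 ≤ arcIntegral n ρ γ.toFun γ.a γ.b

/-- The (conformal) modulus `M(Γ)` of a family of paths in `ℝⁿ`. -/
def modulus (n : ℕ) (Γ : Set (PathOn n)) : ℝ≥0∞ :=
  ⨅ (ρ : EuclideanSpace ℝ (Fin n) → ℝ≥0∞) (_ : IsAdmissibleFor n ρ Γ),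
    ∫⁻ x, ρ x ^ n

/-- The spherical annulus `A(y₀, r₁, r₂) = {y : r₁ < |y − y₀| < r₂}`. -/
def annulus (n : ℕ) (y₀ : EuclideanSpace ℝ (Fin n)) (r₁ r₂ : ℝ) :
    Set (EuclideanSpace ℝ (Fin n)) :=
  {y | r₁ < dist y y₀ ∧ dist y y₀ < r₂}

/-- `Γ(E, F, G)`: the family of all paths `γ : [a,b] → ℝⁿ` with `γ(a) ∈ E`,
`γ(b) ∈ F` and `γ(t) ∈ G` for `t ∈ (a, b)`. -/
def pathsBetween (n : ℕ) (E F G : Set (EuclideanSpace ℝ (Fin n))) : Set (PathOn n) :=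
  {γ | γ.toFun γ.a ∈ E ∧ γ.toFun γ.b ∈ F ∧ ∀ t ∈ Set.Ioo γ.a γ.b, γ.toFun t ∈ G}

/-- `Γ_f(y₀, r₁, r₂)`: the family of all paths `γ` in `D` such that
`f ∘ γ ∈ Γ(S(y₀,r₁), S(y₀,r₂), A(y₀,r₁,r₂))`. -/
def liftedFamily (n : ℕ) (D : Set (EuclideanSpace ℝ (Fin n)))
    (f : EuclideanSpace ℝ (Fin n) → EuclideanSpace ℝ (Fin n))
    (y₀ : EuclideanSpace ℝ (Fin n)) (r₁ r₂ : ℝ) : Set (PathOn n) :=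
  {γ | (∀ t ∈ Set.Icc γ.a γ.b, γ.toFun t ∈ D) ∧
    f (γ.toFun γ.a) ∈ Metric.sphere y₀ r₁ ∧ f (γ.toFun γ.b) ∈ Metric.sphere y₀ r₂ ∧
    ∀ t ∈ Set.Ioo γ.a γ.b, f (γ.toFun t) ∈ annulus n y₀ r₁ r₂}

/-- `f` satisfies the inverse Poletsky inequality at `y₀` with majorant `Q`. -/
def InvPoletsky (n : ℕ) (D : Set (EuclideanSpace ℝ (Fin n)))
    (f : EuclideanSpace ℝ (Fin n) → EuclideanSpace ℝ (Fin n))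
    (Q : EuclideanSpace ℝ (Fin n) → ℝ≥0∞) (y₀ : EuclideanSpace ℝ (Fin n)) : Prop :=
  ∃ r₀ > (0 : ℝ), ∀ r₁ r₂ : ℝ, 0 < r₁ → r₁ < r₂ → r₂ < r₀ →
    ∀ η : ℝ → ℝ≥0∞, Measurable η → 1 ≤ ∫⁻ r in Set.Ioo r₁ r₂, η r →
      modulus n (liftedFamily n D f y₀ r₁ r₂) ≤
        ∫⁻ y in (f '' D) ∩ annulus n y₀ r₁ r₂, Q y * η (dist y y₀) ^ n

/-- `f` is discrete on `D`: every fiber has no accumulation point in `D`. -/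
def IsDiscreteOn (n : ℕ) (D : Set (EuclideanSpace ℝ (Fin n)))
    (f : EuclideanSpace ℝ (Fin n) → EuclideanSpace ℝ (Fin n)) : Prop :=
  ∀ y, ∀ x ∈ D, ¬ AccPt x (Filter.principal {z | z ∈ D ∧ f z = y})

/-- `f` is open on `D`: the image of every open subset of `D` is open. -/
def IsOpenOn (n : ℕ) (D : Set (EuclideanSpace ℝ (Fin n)))
    (f : EuclideanSpace ℝ (Fin n) → EuclideanSpace ℝ (Fin n)) : Prop :=
  ∀ U : Set (EuclideanSpace ℝ (Fin n)), IsOpen U → U ⊆ D → IsOpen (f '' U)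

/-- The chordal (spherical) metric `h(x,y) = |x−y|/(√(1+|x|²)·√(1+|y|²))`. -/
def chordal (n : ℕ) (x y : EuclideanSpace ℝ (Fin n)) : ℝ :=
  dist x y / (Real.sqrt (1 + ‖x‖ ^ 2) * Real.sqrt (1 + ‖y‖ ^ 2))

/-- A family of mappings of `D` is equicontinuous at `x₀ ∈ D` w.r.t. the chordal
metric on the target. -/
def EquicontinuousAtPt (n : ℕ) (D : Set (EuclideanSpace ℝ (Fin n)))
    (𝓕 : Set (EuclideanSpace ℝ (Fin n) → EuclideanSpace ℝ (Fin n)))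
    (x₀ : EuclideanSpace ℝ (Fin n)) : Prop :=
  ∀ ε > (0 : ℝ), ∃ δ > (0 : ℝ), ∀ f ∈ 𝓕, ∀ x ∈ D, dist x x₀ < δ →
    chordal n (f x) (f x₀) < ε

/-- The Stieltjes measures of `F` and `G` are ordered when `G - F` is monotone. -/
lemma Monotone.stieltjes_measure_le_of_monotone_sub {F G : ℝ → ℝ} (hF : Monotone F)
    (hG : Monotone G) (hGF : Monotone fun x => G x - F x) :
    hF.stieltjesFunction.measure ≤ hG.stieltjesFunction.measure := by
  have h : hG.stieltjesFunction = hF.stieltjesFunction + hGF.stieltjesFunction := by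
    ext x
    rw [StieltjesFunction.add_apply, hG.stieltjesFunction_eq, hF.stieltjesFunction_eq,
      hGF.stieltjesFunction_eq]
    have h1 := (hF.tendsto_rightLim x).add (hGF.tendsto_rightLim x)
    simp only [add_sub_cancel] at h1
    exact tendsto_nhds_unique (hG.tendsto_rightLim x) h1
  rw [h, StieltjesFunction.measure_add]
  exact Measure.le_add_right le_rfl

section
variable {n : ℕ}

lemma varFun_sub_varFun {γ : ℝ → EuclideanSpace ℝ (Fin n)} {a b : ℝ} (hab : a ≤ b)
    (hγ : BoundedVariationOn γ (Icc a b)) {x y : ℝ} (hxy : x ≤ y) :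
    varFun n γ a b y - varFun n γ a b x =
      (eVariationOn γ (Icc (max a (min x b)) (max a (min y b)))).toReal := by
  have hx : a ≤ max a (min x b) := le_max_left _ _
  have hm : max a (min x b) ≤ max a (min y b) := by gcongr
  have hy : max a (min y b) ≤ b := max_le hab (min_le_right _ _)
  have h := eVariationOn.Icc_add_Icc γ (s := univ) hx hm (mem_univ _)
  simp only [univ_inter] at h
  unfold varFun
  rw [← h, ENNReal.toReal_add, add_sub_cancel_left]
  · exact hγ.mono (Icc_subset_Icc le_rfl (hm.trans hy))
  · exact hγ.mono (Icc_subset_Icc hx hy)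

lemma monotone_varFun {γ : ℝ → EuclideanSpace ℝ (Fin n)} {a b : ℝ} (hab : a ≤ b)
    (hγ : BoundedVariationOn γ (Icc a b)) : Monotone (varFun n γ a b) := by
  intro x y hxy
  have := varFun_sub_varFun hab hγ hxy
  rw [← sub_nonneg, this]
  positivity

/-- The arc-length integral over a subpath is at most the integral over the whole path. -/
lemma arcIntegral_le_of_subinterval {ρ : EuclideanSpace ℝ (Fin n) → ℝ≥0∞}
    {γ : ℝ → EuclideanSpace ℝ (Fin n)} {a b c d : ℝ} (hac : a ≤ c) (hcd : c ≤ d) (hdb : d ≤ b) :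
    arcIntegral n ρ γ c d ≤ arcIntegral n ρ γ a b := by
  have hab : a ≤ b := hac.trans (hcd.trans hdb)
  have hsub : Icc c d ⊆ Icc a b := Icc_subset_Icc hac hdb
  by_cases h : BoundedVariationOn γ (Icc a b)
  · have h' : BoundedVariationOn γ (Icc c d) := h.mono hsub
    have hm := monotone_varFun hab h
    have hm' := monotone_varFun hcd h'
    unfold arcIntegral
    rw [dif_pos ⟨h', hm'⟩, dif_pos ⟨h, hm⟩]
    refine lintegral_mono' (Measure.restrict_mono hsub ?_) le_rfl
    refine hm'.stieltjes_measure_le_of_monotone_sub hm ?_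
    intro x y hxy
    have h1 := varFun_sub_varFun hab h hxy
    have h2 := varFun_sub_varFun hcd h' hxy
    suffices (eVariationOn γ (Icc (max c (min x d)) (max c (min y d)))).toReal ≤
        (eVariationOn γ (Icc (max a (min x b)) (max a (min y b)))).toReal by
      simp only; linarith
    refine ENNReal.toReal_mono (h.mono (Icc_subset_Icc (le_max_left _ _)
      (max_le hab (min_le_right _ _)))) ?_
    by_cases hlt : max c (min x d) < max c (min y d)
    · refine eVariationOn.mono γ (Icc_subset_Icc ?_ ?_)
      · refine max_le (hac.trans (le_max_left _ _)) ?_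
        by_cases hxd : x ≤ d
        · rw [min_eq_left hxd, min_eq_left (hxd.trans hdb)]; exact le_max_right _ _
        · push Not at hxd
          rw [min_eq_right hxd.le, min_eq_right (hxd.le.trans hxy)] at hlt
          exact absurd hlt (lt_irrefl _)
      · have hcy : c < y := by
          by_contra hyc
          push Not at hyc
          rw [max_eq_left ((min_le_left y d).trans hyc)] at hlt
          exact absurd hlt (not_lt.2 (le_max_left _ _))
        refine le_trans ?_ (le_max_right _ _)
        exact max_le (le_min hcy.le (hcd.trans hdb)) (min_le_min le_rfl hdb)
    · rw [eVariationOn.subsingleton]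
      · exact zero_le
      · exact subsingleton_Icc_of_ge (not_lt.1 hlt)
  · refine le_top.trans_eq ?_
    rw [arcIntegral, dif_neg (fun H => h H.1)]

/-- The arc-length integral along a Lipschitz path is bounded by the parametrized integral. -/
lemma arcIntegral_le_of_lipschitz {ρ : EuclideanSpace ℝ (Fin n) → ℝ≥0∞}
    {γ : ℝ → EuclideanSpace ℝ (Fin n)} {K : ℝ≥0} (hγ : LipschitzWith K γ)
    {a b : ℝ} (hab : a ≤ b) :
    arcIntegral n ρ γ a b ≤ K * ∫⁻ t in Icc a b, ρ (γ t) := by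
  have key : ∀ u v : ℝ, u ≤ v → eVariationOn γ (Icc u v) ≤ K * ENNReal.ofReal (v - u) := by
    intro u v huv
    have h1 := (hγ.lipschitzOnWith (s := Icc u v)).comp_eVariationOn_le
      (g := (id : ℝ → ℝ)) (s := Icc u v) (fun x hx => hx)
    have h2 := ((monotoneOn_id (s := Icc u v)).eVariationOn_eq (a := u) (b := v)
      ⟨le_rfl, huv⟩ ⟨huv, le_rfl⟩).le
    rw [inter_self] at h2
    exact h1.trans (by gcongr; exact h2)
  have hbv : BoundedVariationOn γ (Icc a b) :=
    ne_top_of_le_ne_top (by finiteness) (key a b hab)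
  have hm := monotone_varFun hab hbv
  have hlin : Monotone fun x : ℝ => (K : ℝ) * x := fun x y hxy => by
    simp only; gcongr
  have hmeas : hlin.stieltjesFunction.measure = K • (volume : Measure ℝ) := by
    rw [Real.volume_eq_stieltjes_id, ← StieltjesFunction.measure_smul]
    congr 1
    ext x
    rw [hlin.stieltjesFunction_eq]
    exact tendsto_nhds_unique (hlin.tendsto_rightLim x)
      ((continuous_const.mul continuous_id).tendsto x |>.mono_left nhdsWithin_le_nhds)
  have hle : hm.stieltjesFunction.measure ≤ K • (volume : Measure ℝ) := by
    rw [← hmeas]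
    refine hm.stieltjes_measure_le_of_monotone_sub hlin fun x y hxy => ?_
    have h1 := varFun_sub_varFun hab hbv hxy
    have h2 : (eVariationOn γ (Icc (max a (min x b)) (max a (min y b)))).toReal ≤
        K * (y - x) := by
      have hmm : max a (min x b) ≤ max a (min y b) := by gcongr
      have hd : max a (min y b) - max a (min x b) ≤ y - x := by
        have := abs_max_sub_max_le_abs (min y b) (min x b) a
        have h' := abs_min_sub_min_le_max y b x b
        rw [max_comm a, max_comm a]
        rw [sub_self, abs_zero, max_eq_left (abs_nonneg _), abs_of_nonneg (sub_nonneg.2 hxy)] at h'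
        exact (le_abs_self _).trans (this.trans h')
      refine ENNReal.toReal_le_of_le_ofReal (mul_nonneg K.2 (sub_nonneg.2 hxy)) ?_
      refine (key _ _ hmm).trans ?_
      rw [ENNReal.ofReal_mul K.coe_nonneg, ENNReal.ofReal_coe_nnreal]
      gcongr
    simp only
    linarith
  rw [arcIntegral, dif_pos ⟨hbv, hm⟩]
  calc _ ≤ ∫⁻ t in Icc a b, ρ (γ t) ∂(K • (volume : Measure ℝ)) :=
        lintegral_mono' (Measure.restrict_mono le_rfl hle) le_rfl
    _ = _ := by
        rw [Measure.restrict_smul, lintegral_smul_measure]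
        rfl

/-- The arc-length integral is countably superadditive. -/
lemma tsum_arcIntegral_le {ι : Type*} [Countable ι] {c : ι → ℝ≥0∞}
    {ρ : ι → EuclideanSpace ℝ (Fin n) → ℝ≥0∞}
    (hρ : ∀ i, Measurable (ρ i)) {γ : ℝ → EuclideanSpace ℝ (Fin n)} {a b : ℝ}
    (hγ : ContinuousOn γ (Icc a b)) :
    ∑' i, c i * arcIntegral n (ρ i) γ a b ≤ arcIntegral n (fun x => ∑' i, c i * ρ i x) γ a b := by
  by_cases h : BoundedVariationOn γ (Icc a b) ∧ Monotone (varFun n γ a b)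
  · simp only [arcIntegral, dif_pos h]
    have hm : ∀ i, AEMeasurable (fun t => ρ i (γ t))
        (h.2.stieltjesFunction.measure.restrict (Icc a b)) := fun i =>
      (hρ i).comp_aemeasurable (hγ.aemeasurable measurableSet_Icc)
    rw [lintegral_tsum fun i => (hm i).const_mul _]
    refine (tsum_congr fun i => ?_).le
    rw [lintegral_const_mul'' _ (hm i)]
  · rw [arcIntegral, dif_neg h]
    exact le_top

lemma arcIntegral_congr {ρ ρ' : EuclideanSpace ℝ (Fin n) → ℝ≥0∞}
    {γ : ℝ → EuclideanSpace ℝ (Fin n)} {a b : ℝ} (h : ∀ t ∈ Icc a b, ρ (γ t) = ρ' (γ t)) :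
    arcIntegral n ρ γ a b = arcIntegral n ρ' γ a b := by
  unfold arcIntegral
  split_ifs with h'
  · exact setLIntegral_congr_fun measurableSet_Icc h
  · rfl

lemma exists_crossing_subinterval {g : ℝ → ℝ} {τ β A B : ℝ} (hτβ : τ ≤ β)
    (hg : ContinuousOn g (Icc τ β)) (hA : g τ ≤ A) (hAB : A < B) (hB : B ≤ g β) :
    ∃ s₁ s₂, τ ≤ s₁ ∧ s₁ ≤ s₂ ∧ s₂ ≤ β ∧ g s₁ = A ∧ g s₂ = B ∧
      ∀ t ∈ Ioo s₁ s₂, A < g t ∧ g t < B := by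
  have hcl : IsCompact {t ∈ Icc τ β | g t = B} :=
    isCompact_Icc.of_isClosed_subset
      (hg.preimage_isClosed_of_isClosed isClosed_Icc (isClosed_singleton (x := B))) (sep_subset _ _)
  obtain ⟨t₀, ht₀, ht₀B⟩ := intermediate_value_Icc hτβ hg ⟨hA.trans hAB.le, hB⟩
  obtain ⟨s₂, ⟨hs₂, hs₂B⟩, hmin⟩ := hcl.exists_isLeast ⟨t₀, ht₀, ht₀B⟩
  have hg' : ContinuousOn g (Icc τ s₂) := hg.mono (Icc_subset_Icc le_rfl hs₂.2)
  have hcl' : IsCompact {t ∈ Icc τ s₂ | g t = A} :=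
    isCompact_Icc.of_isClosed_subset
      (hg'.preimage_isClosed_of_isClosed isClosed_Icc (isClosed_singleton (x := A)))
      (sep_subset _ _)
  obtain ⟨t₁, ht₁, ht₁A⟩ := intermediate_value_Icc hs₂.1 hg' ⟨hA, hs₂B ▸ hAB.le⟩
  obtain ⟨s₁, ⟨hs₁, hs₁A⟩, hmax⟩ := hcl'.exists_isGreatest ⟨t₁, ht₁, ht₁A⟩
  refine ⟨s₁, s₂, hs₁.1, hs₁.2, hs₂.2, hs₁A, hs₂B, fun t ht => ⟨?_, ?_⟩⟩
  · by_contra hcon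
    push Not at hcon
    obtain ⟨u, hu, huA⟩ := intermediate_value_Icc ht.2.le
      (hg'.mono (Icc_subset_Icc (hs₁.1.trans ht.1.le) le_rfl)) ⟨hcon, hs₂B ▸ hAB.le⟩
    exact absurd (hmax ⟨⟨hs₁.1.trans (ht.1.le.trans hu.1), hu.2⟩, huA⟩)
      (not_le.2 (ht.1.trans_le hu.1))
  · by_contra hcon
    push Not at hcon
    obtain ⟨u, hu, huB⟩ := intermediate_value_Icc ht.1.le
      (hg'.mono (Icc_subset_Icc hs₁.1 ht.2.le)) ⟨hs₁A ▸ hAB.le, hcon⟩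
    exact absurd (hmin ⟨⟨hs₁.1.trans hu.1, hu.2.trans (ht.2.le.trans hs₂.2)⟩, huB⟩)
      (not_le.2 (hu.2.trans_lt ht.2))

/-- A path whose image runs from the ball of radius `r₁` to the complement of the ball of radius
`r₂` has arc-length integral at least one for any density admissible for the lifted family,
even after cutting the density off outside the preimage of the closed ball. -/
lemma one_le_arcIntegral_of_crossing {D : Set (EuclideanSpace ℝ (Fin n))}
    {f : EuclideanSpace ℝ (Fin n) → EuclideanSpace ℝ (Fin n)} (hf : ContinuousOn f D)
    {c : EuclideanSpace ℝ (Fin n)} {r₁ r₂ : ℝ} (hr : r₁ < r₂)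
    {ρ : EuclideanSpace ℝ (Fin n) → ℝ≥0∞} (hρ : IsAdmissibleFor n ρ (liftedFamily n D f c r₁ r₂))
    (γ : PathOn n) (hγ : ∀ t ∈ Icc γ.a γ.b, γ.toFun t ∈ D) {τ : ℝ} (hτ : τ ∈ Icc γ.a γ.b)
    (h₁ : dist (f (γ.toFun τ)) c ≤ r₁) (h₂ : r₂ ≤ dist (f (γ.toFun γ.b)) c) :
    1 ≤ arcIntegral n ((D ∩ f ⁻¹' closedBall c r₂).indicator ρ) γ.toFun γ.a γ.b := by
  have hc : ContinuousOn (fun t => dist (f (γ.toFun t)) c) (Icc γ.a γ.b) :=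
    (continuous_id.dist continuous_const).comp_continuousOn (hf.comp γ.cont hγ)
  obtain ⟨s₁, s₂, hs₁, hs, hs₂, e₁, e₂, hmid⟩ := exists_crossing_subinterval hτ.2
    (hc.mono (Icc_subset_Icc hτ.1 le_rfl)) h₁ hr h₂
  have hsub : Icc s₁ s₂ ⊆ Icc γ.a γ.b := Icc_subset_Icc (hτ.1.trans hs₁) hs₂
  have h := hρ.2 ⟨s₁, s₂, hs, γ.toFun, γ.cont.mono hsub⟩
    ⟨fun t ht => hγ t (hsub ht), mem_sphere.2 e₁, mem_sphere.2 e₂, fun t ht => hmid t ht⟩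
  refine h.trans (Eq.trans_le ?_ (arcIntegral_le_of_subinterval (hτ.1.trans hs₁) hs hs₂))
  refine arcIntegral_congr fun t ht => ?_
  rw [indicator_of_mem]
  refine ⟨hγ t (hsub ht), ?_⟩
  rw [mem_preimage, mem_closedBall]
  rcases eq_or_lt_of_le ht.1 with rfl | h1
  · exact e₁.le.trans hr.le
  rcases eq_or_lt_of_le ht.2 with rfl | h2
  · exact e₂.le
  exact (hmid t ⟨h1, h2⟩).2.le

end

lemma ENNReal.sum_pow_le_card_pow_mul {ι : Type*} (T : Finset ι) (a : ι → ℝ≥0∞) (n : ℕ)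
    (hn : n ≠ 0) : (∑ i ∈ T, a i) ^ n ≤ (T.card : ℝ≥0∞) ^ n * ∑ i ∈ T, a i ^ n := by
  rcases T.eq_empty_or_nonempty with rfl | hT
  · simp [hn]
  obtain ⟨i, hi, hmax⟩ := T.exists_max_image a hT
  have h1 : ∑ j ∈ T, a j ≤ T.card * a i := by
    rw [← nsmul_eq_mul]
    exact T.sum_le_card_nsmul a (a i) hmax
  calc (∑ j ∈ T, a j) ^ n ≤ (T.card * a i) ^ n := by gcongr
    _ = (T.card : ℝ≥0∞) ^ n * a i ^ n := mul_pow _ _ _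
    _ ≤ _ := by
      gcongr
      exact Finset.single_le_sum (f := fun j => a j ^ n) (fun _ _ => zero_le) hi

/-- `Lⁿ` bound for a sum of functions with overlap at most `N`. -/
lemma lintegral_tsum_pow_le {X ι : Type*} [Countable ι] [MeasurableSpace X] {μ : Measure X}
    {g : ι → X → ℝ≥0∞} (hg : ∀ i, Measurable (g i)) {n N : ℕ} (hn : n ≠ 0)
    (hN : ∀ x, ∃ T : Finset ι, T.card ≤ N ∧ ∀ i ∉ T, g i x = 0) :
    ∫⁻ x, (∑' i, g i x) ^ n ∂μ ≤ (N : ℝ≥0∞) ^ n * ∑' i, ∫⁻ x, g i x ^ n ∂μ := by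
  rw [← lintegral_tsum fun i => ((hg i).pow_const n).aemeasurable,
    ← lintegral_const_mul _ (Measurable.tsum fun i => (hg i).pow_const n)]
  refine lintegral_mono fun x => ?_
  obtain ⟨T, hT, h0⟩ := hN x
  simp only
  rw [tsum_eq_sum fun i hi => h0 i hi,
    tsum_eq_sum fun i hi => by rw [h0 i hi, zero_pow hn]]
  refine (ENNReal.sum_pow_le_card_pow_mul T _ n hn).trans ?_
  gcongr

lemma tsum_measure_le_of_overlap {X ι : Type*} [Countable ι] [MeasurableSpace X] {μ : Measure X}
    {W : ι → Set X} (hW : ∀ i, MeasurableSet (W i)) {N : ℕ} {A : Set X} (hA : ∀ i, W i ⊆ A)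
    (hAm : MeasurableSet A)
    (hN : ∀ x, ∃ T : Finset ι, T.card ≤ N ∧ ∀ i ∉ T, x ∉ W i) :
    ∑' i, μ (W i) ≤ N * μ A := by
  have h1 : ∀ i, μ (W i) = ∫⁻ x, (W i).indicator 1 x ∂μ := fun i =>
    (lintegral_indicator_one (hW i)).symm
  simp only [h1]
  rw [← lintegral_tsum fun i => (measurable_one.indicator (hW i)).aemeasurable,
    ← lintegral_indicator_one hAm, ← lintegral_const_mul _ (measurable_one.indicator hAm)]
  refine lintegral_mono fun x => ?_
  obtain ⟨T, hT, h0⟩ := hN x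
  simp only
  rw [tsum_eq_sum fun i hi => indicator_of_notMem (h0 i hi) _]
  by_cases hx : x ∈ A
  · rw [indicator_of_mem hx]
    calc ∑ i ∈ T, (W i).indicator (1 : X → ℝ≥0∞) x ≤ T.card • (1 : ℝ≥0∞) :=
          T.sum_le_card_nsmul _ _ fun i _ => indicator_le_self' (by simp) x
      _ ≤ _ := by
          rw [nsmul_eq_mul]
          simp only [Pi.one_apply]
          gcongr
  · rw [Finset.sum_eq_zero fun i _ => indicator_of_notMem (fun h => hx (hA i h)) _]
    exact zero_le

/-- The cell of the cubic lattice of mesh `s` containing `y`. -/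
def latticeCell (n : ℕ) (s : ℝ) (y : EuclideanSpace ℝ (Fin n)) : Fin n → ℤ := fun i => ⌊y i / s⌋

lemma abs_apply_sub_le_dist {n : ℕ} (x y : EuclideanSpace ℝ (Fin n)) (i : Fin n) :
    |x i - y i| ≤ dist x y := by
  have := PiLp.norm_apply_le (x - y) i
  rwa [PiLp.sub_apply, Real.norm_eq_abs, ← dist_eq_norm] at this

lemma dist_le_of_latticeCell_eq {n : ℕ} {s : ℝ} (hs : 0 < s) {x y : EuclideanSpace ℝ (Fin n)}
    (h : latticeCell n s x = latticeCell n s y) : dist x y ≤ n * s := by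
  have h1 : ∀ i, |x i - y i| ≤ s := fun i => by
    have h2 : |x i / s - y i / s| < 1 := Int.abs_sub_lt_one_of_floor_eq_floor (congrFun h i)
    rw [← sub_div, abs_div, abs_of_pos hs, div_lt_one hs] at h2
    exact h2.le
  rw [dist_eq_norm]
  rcases n.eq_zero_or_pos with rfl | hn
  · rw [Subsingleton.elim (x - y) 0]; simp
  refine (EuclideanSpace.norm_eq _).trans_le (Real.sqrt_le_iff.2 ⟨by positivity, ?_⟩)
  calc ∑ i, ‖(x - y) i‖ ^ 2 ≤ ∑ _i : Fin n, s ^ 2 := by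
        refine Finset.sum_le_sum fun i _ => ?_
        gcongr
        exact h1 i
    _ = n * s ^ 2 := by simp
    _ ≤ (n * s) ^ 2 := by
        rw [mul_pow]
        gcongr
        exact_mod_cast Nat.le_self_pow two_ne_zero n

/-- Only boundedly many lattice cells come close to a given point. -/
lemma exists_finset_latticeCell {n : ℕ} {s : ℝ} (hs : 0 < s) (m : ℕ)
    (y : EuclideanSpace ℝ (Fin n)) :
    ∃ T : Finset (Fin n → ℤ), T.card ≤ (2 * m + 3) ^ n ∧
      ∀ x, dist y x ≤ m * s → latticeCell n s x ∈ T := by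
  refine ⟨Fintype.piFinset fun i => Finset.Icc (⌊y i / s⌋ - (m + 1)) (⌊y i / s⌋ + (m + 1)), ?_, ?_⟩
  · rw [Fintype.card_piFinset]
    simp only [Int.card_Icc]
    refine (Finset.prod_congr rfl fun i _ => ?_).trans_le
      ((Finset.prod_const (2 * m + 3)).trans (by simp)).le
    omega
  · intro x hx
    rw [Fintype.mem_piFinset]
    intro i
    have h1 : |y i - x i| ≤ m * s := (abs_apply_sub_le_dist y x i).trans hx
    have h2 : |y i / s - x i / s| ≤ m := by
      rw [← sub_div, abs_div, abs_of_pos hs, div_le_iff₀ hs]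
      exact h1
    obtain ⟨h3, h4⟩ := abs_le.1 h2
    rw [Finset.mem_Icc]
    simp only [latticeCell]
    have e1 := Int.floor_le (y i / s)
    have e2 := Int.lt_floor_add_one (y i / s)
    have e3 := Int.floor_le (x i / s)
    have e4 := Int.lt_floor_add_one (x i / s)
    constructor
    · have : ((⌊y i / s⌋ - (m + 1) : ℤ) : ℝ) < ((⌊x i / s⌋ + 1 : ℤ) : ℝ) := by
        push_cast; linarith
      have := Int.cast_lt.1 this
      omega
    · have : ((⌊x i / s⌋ : ℤ) : ℝ) < ((⌊y i / s⌋ + (m + 1) + 1 : ℤ) : ℝ) := by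
        push_cast; linarith
      have := Int.cast_lt.1 this
      omega

/-- The bound for the overlap of the lattice balls used in `exists_density_of_uniform_radius`. -/
def overlapBound (n : ℕ) : ℕ := (2 * (2 * n + 4) + 3) ^ n

/-- The inverse Poletsky inequality for the annulus `A(c, ϱ, 2ϱ)` and constant `η`, in terms of
admissible densities and a measure `ν` on the target. -/
def HasDensityAt (n : ℕ) (D : Set (EuclideanSpace ℝ (Fin n)))
    (f : EuclideanSpace ℝ (Fin n) → EuclideanSpace ℝ (Fin n))
    (ν : Measure (EuclideanSpace ℝ (Fin n))) (c : EuclideanSpace ℝ (Fin n)) (r : ℝ) : Prop :=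
  ∃ ρ, IsAdmissibleFor n ρ (liftedFamily n D f c r (2 * r)) ∧
    ENNReal.ofReal r ^ n * ∫⁻ x, ρ x ^ n ≤ ν (closedBall c (2 * r))

/-- If the inverse Poletsky inequality holds at all points of `S` with a common radius, then a
single density measures the trace, near `L ⊆ closure S`, of the images of paths. -/
lemma exists_density_of_uniform_radius {n : ℕ} (hn : n ≠ 0)
    {D : Set (EuclideanSpace ℝ (Fin n))} (hD : IsOpen D)
    {f : EuclideanSpace ℝ (Fin n) → EuclideanSpace ℝ (Fin n)} (hf : ContinuousOn f D)
    (ν : Measure (EuclideanSpace ℝ (Fin n))) {S L : Set (EuclideanSpace ℝ (Fin n))}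
    (hL : L ⊆ closure S) {s : ℝ} (hs : 0 < s)
    (hS : ∀ c ∈ S, HasDensityAt n D f ν c ((n + 2) * s)) :
    ∃ ρ : EuclideanSpace ℝ (Fin n) → ℝ≥0∞, Measurable ρ ∧
      ∫⁻ x, ρ x ^ n ≤ (overlapBound n : ℝ≥0∞) ^ (n + 1) * ν (cthickening ((2 * n + 5) * s) L) ∧
      ∀ γ : PathOn n, (∀ t ∈ Icc γ.a γ.b, γ.toFun t ∈ D) →
        ∀ u : EuclideanSpace ℝ (Fin n) → ℝ, LipschitzWith 1 u → ∀ κ : ℝ,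
          κ + 3 * ((n + 2) * s) ≤ u (f (γ.toFun γ.b)) →
          volume (u '' {y | y ∈ (fun t => f (γ.toFun t)) '' Icc γ.a γ.b ∧ y ∈ thickening s L ∧
            u y ≤ κ}) ≤ 2 * arcIntegral n ρ γ.toFun γ.a γ.b := by
  set r : ℝ := (n + 2) * s with hr
  have hr0 : 0 < r := by positivity
  let V : (Fin n → ℤ) → Prop := fun v => ∃ y ∈ S ∩ thickening s L, latticeCell n s y = v
  have hex : ∀ v, ∃ (c : EuclideanSpace ℝ (Fin n)) (ρ : EuclideanSpace ℝ (Fin n) → ℝ≥0∞),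
      V v → c ∈ thickening s L ∧ latticeCell n s c = v ∧
        IsAdmissibleFor n ρ (liftedFamily n D f c r (2 * r)) ∧
        ENNReal.ofReal r ^ n * ∫⁻ x, ρ x ^ n ≤ ν (closedBall c (2 * r)) := by
    intro v
    by_cases hv : V v
    · obtain ⟨y, hy, hyv⟩ := hv
      obtain ⟨ρ, h1, h2⟩ := hS y hy.1
      exact ⟨y, ρ, fun _ => ⟨hy.2, hyv, h1, h2⟩⟩
    · exact ⟨0, 0, fun h => absurd h hv⟩
  choose c R hcR using hex
  let P : (Fin n → ℤ) → Set (EuclideanSpace ℝ (Fin n)) :=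
    fun v => D ∩ f ⁻¹' closedBall (c v) (2 * r)
  have hP : ∀ v, MeasurableSet (P v) := fun v => by
    have : P v = D \ (D ∩ f ⁻¹' (closedBall (c v) (2 * r))ᶜ) := by
      ext x; simp [P]
    rw [this]
    exact hD.measurableSet.diff
      (hf.isOpen_inter_preimage hD isClosed_closedBall.isOpen_compl).measurableSet
  let G : (Fin n → ℤ) → EuclideanSpace ℝ (Fin n) → ℝ≥0∞ :=
    fun v => if V v then (P v).indicator (R v) else 0
  have hG : ∀ v, Measurable (G v) := fun v => by
    by_cases hv : V v
    · simp only [G, if_pos hv]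
      exact (hcR v hv).2.2.1.1.indicator (hP v)
    · simp only [G, if_neg hv]
      exact measurable_zero
  let W : (Fin n → ℤ) → Set (EuclideanSpace ℝ (Fin n)) :=
    fun v => if V v then closedBall (c v) (2 * r) else ∅
  have hW : ∀ y, ∃ T : Finset (Fin n → ℤ), T.card ≤ overlapBound n ∧ ∀ v ∉ T, y ∉ W v := by
    intro y
    obtain ⟨T, hT, hTy⟩ := exists_finset_latticeCell hs (2 * n + 4) y
    refine ⟨T, hT, fun v hv hy => ?_⟩
    by_cases hV : V v
    · simp only [W, if_pos hV, mem_closedBall] at hy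
      refine hv ?_
      rw [← (hcR v hV).2.1]
      refine hTy _ (hy.trans_eq ?_)
      rw [hr]; push_cast; ring
    · simp [W, hV] at hy
  refine ⟨fun x => ∑' v, ENNReal.ofReal r * G v x,
    Measurable.tsum fun v => (hG v).const_mul _, ?_, ?_⟩
  · have h1 := lintegral_tsum_pow_le (μ := volume) (g := fun v x => ENNReal.ofReal r * G v x)
      (fun v => (hG v).const_mul _) (N := overlapBound n) hn (fun x => by
        obtain ⟨T, hT, hTy⟩ := hW (f x)
        refine ⟨T, hT, fun v hv => ?_⟩
        by_cases hV : V v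
        · have := hTy v hv
          simp only [W, if_pos hV] at this
          simp only [G, if_pos hV]
          rw [indicator_of_notMem (fun h => this h.2), mul_zero]
        · simp [G, hV])
    refine h1.trans ?_
    rw [pow_succ, mul_assoc]
    gcongr
    have h2 : ∀ v, ∫⁻ x, (ENNReal.ofReal r * G v x) ^ n ≤ ν (W v) := by
      intro v
      by_cases hV : V v
      · simp only [W, G, if_pos hV]
        refine le_trans ?_ (hcR v hV).2.2.2
        rw [← lintegral_const_mul _ ((hcR v hV).2.2.1.1.pow_const n)]
        refine lintegral_mono fun x => ?_
        simp only
        rw [mul_pow]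
        gcongr
        exact indicator_le_self _ _ x
      · simp [W, G, hV, hn]
    refine (ENNReal.tsum_le_tsum h2).trans ?_
    refine tsum_measure_le_of_overlap (fun v => ?_) (fun v => ?_)
      isClosed_cthickening.measurableSet hW
    · by_cases hV : V v
      · simp only [W, if_pos hV]; exact isClosed_closedBall.measurableSet
      · simp [W, hV]
    · by_cases hV : V v
      · simp only [W, if_pos hV]
        intro y hy
        obtain ⟨z, hz, hzc⟩ := mem_thickening_iff.1 (hcR v hV).1
        refine mem_cthickening_of_dist_le y z _ _ hz ?_
        have := dist_triangle y (c v) z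
        rw [mem_closedBall, hr] at hy
        linarith
      · simp [W, hV]
  · intro γ hγ u hu κ hκ
    refine le_trans ?_ (mul_le_mul_right (tsum_arcIntegral_le hG γ.cont) 2)
    let J : (Fin n → ℤ) → Set ℝ := fun v =>
      if V v ∧ u (c v) ≤ κ + r ∧ ∃ τ ∈ Icc γ.a γ.b, dist (f (γ.toFun τ)) (c v) ≤ r
      then closedBall (u (c v)) r else ∅
    have hJ : ∀ v, volume (J v) ≤ 2 * (ENNReal.ofReal r * arcIntegral n (G v) γ.toFun γ.a γ.b) := by
      intro v
      by_cases hv : V v ∧ u (c v) ≤ κ + r ∧ ∃ τ ∈ Icc γ.a γ.b, dist (f (γ.toFun τ)) (c v) ≤ r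
      · obtain ⟨hV, huc, τ, hτ, hd⟩ := id hv
        simp only [J, if_pos hv, G, if_pos hV]
        have hend : 2 * r ≤ dist (f (γ.toFun γ.b)) (c v) := by
          have := hu.dist_le_mul (f (γ.toFun γ.b)) (c v)
          rw [Real.dist_eq, NNReal.coe_one, one_mul] at this
          have := le_abs_self (u (f (γ.toFun γ.b)) - u (c v))
          linarith
        have := one_le_arcIntegral_of_crossing hf (by linarith) (hcR v hV).2.2.1 γ hγ hτ hd hend
        rw [Real.volume_closedBall, ENNReal.ofReal_mul (by norm_num), ENNReal.ofReal_ofNat]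
        gcongr
        exact le_mul_of_one_le_right zero_le this
      · simp only [J, if_neg hv, measure_empty, zero_le]
    rw [← ENNReal.tsum_mul_left]
    refine le_trans (measure_mono ?_) ((measure_iUnion_le J).trans (ENNReal.tsum_le_tsum hJ))
    rintro _ ⟨y, ⟨⟨τ, hτ, rfl⟩, hyL, hyκ⟩, rfl⟩
    simp only at hyL hyκ ⊢
    obtain ⟨l, hl, hyl⟩ := mem_thickening_iff.1 hyL
    obtain ⟨z, hz, hlz⟩ := Metric.mem_closure_iff.1 (hL hl) s hs
    have hV : V (latticeCell n s z) :=
      ⟨z, ⟨hz, mem_thickening_iff.2 ⟨l, hl, by rwa [dist_comm]⟩⟩, rfl⟩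
    have hzc : dist z (c (latticeCell n s z)) ≤ n * s :=
      dist_le_of_latticeCell_eq hs (hcR _ hV).2.1.symm
    have hd : dist (f (γ.toFun τ)) (c (latticeCell n s z)) ≤ r := by
      have h1 := dist_triangle (f (γ.toFun τ)) l z
      have h2 := dist_triangle (f (γ.toFun τ)) z (c (latticeCell n s z))
      rw [hr]; linarith
    have hud := hu.dist_le_mul (f (γ.toFun τ)) (c (latticeCell n s z))
    rw [NNReal.coe_one, one_mul] at hud
    refine mem_iUnion.2 ⟨latticeCell n s z, ?_⟩
    have : u (c (latticeCell n s z)) ≤ κ + r := by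
      rw [Real.dist_eq] at hud
      have := neg_abs_le (u (f (γ.toFun τ)) - u (c (latticeCell n s z)))
      linarith
    simp only [J]
    rw [if_pos ⟨hV, this, τ, hτ, hd⟩, mem_closedBall]
    exact hud.trans hd

lemma InvPoletsky.exists_hasDensityAt {n : ℕ} (hn : n ≠ 0)
    {D : Set (EuclideanSpace ℝ (Fin n))} {f : EuclideanSpace ℝ (Fin n) → EuclideanSpace ℝ (Fin n)}
    {Q : EuclideanSpace ℝ (Fin n) → ℝ≥0∞} (hQ : Measurable Q)
    (hQloc : ∀ K : Set (EuclideanSpace ℝ (Fin n)), IsCompact K → (∫⁻ y in K, Q y) < ∞)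
    {c : EuclideanSpace ℝ (Fin n)} (h : InvPoletsky n D f Q c) :
    ∃ r₀ > (0 : ℝ), ∀ r > 0, 2 * r < r₀ →
      HasDensityAt n D f (volume.withDensity fun y => Q y + 1) c r := by
  obtain ⟨r₀, hr₀, h⟩ := h
  refine ⟨r₀, hr₀, fun r hr hr2 => ?_⟩
  have hr0 : ENNReal.ofReal r ≠ 0 := by simpa using hr
  have hrt : ENNReal.ofReal r ≠ ∞ := ENNReal.ofReal_ne_top
  have h1 := h r (2 * r) hr (by linarith) hr2 (fun _ => (ENNReal.ofReal r)⁻¹) measurable_const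
    (by
      rw [setLIntegral_const, Real.volume_Ioo, show 2 * r - r = r by ring,
        ENNReal.inv_mul_cancel hr0 hrt])
  have hvol : (0 : ℝ≥0∞) < volume (closedBall c (2 * r)) :=
    measure_closedBall_pos volume c (by linarith)
  have hνeq : (volume.withDensity fun y => Q y + 1) (closedBall c (2 * r)) =
      (∫⁻ y in closedBall c (2 * r), Q y) + volume (closedBall c (2 * r)) := by
    rw [withDensity_apply _ measurableSet_closedBall, lintegral_add_left hQ]
    simp
  have h2 : (∫⁻ y in (f '' D) ∩ annulus n c r (2 * r), Q y * (ENNReal.ofReal r)⁻¹ ^ n) <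
      (ENNReal.ofReal r)⁻¹ ^ n * (volume.withDensity fun y => Q y + 1) (closedBall c (2 * r)) := by
    calc _ ≤ ∫⁻ y in closedBall c (2 * r), Q y * (ENNReal.ofReal r)⁻¹ ^ n := by
          apply lintegral_mono_set
          rintro y ⟨-, hy⟩
          exact hy.2.le
      _ = (ENNReal.ofReal r)⁻¹ ^ n * ∫⁻ y in closedBall c (2 * r), Q y := by
          rw [lintegral_mul_const _ hQ, mul_comm]
      _ < _ := by
          rw [hνeq]
          refine ENNReal.mul_lt_mul_right (by simp [hn]) (by simp [hn, hr]) ?_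
          exact ENNReal.lt_add_right (hQloc _ (isCompact_closedBall _ _)).ne hvol.ne'
  have h3 := h1.trans_lt h2
  simp only [modulus, iInf_lt_iff] at h3
  obtain ⟨ρ, hρ, hlt⟩ := h3
  refine ⟨ρ, hρ, ?_⟩
  calc _ ≤ ENNReal.ofReal r ^ n * ((ENNReal.ofReal r)⁻¹ ^ n *
        (volume.withDensity fun y => Q y + 1) (closedBall c (2 * r))) := by gcongr
    _ = _ := by
      rw [← mul_assoc, ← mul_pow, ENNReal.mul_inv_cancel hr0 hrt, one_pow, one_mul]

/-- A compact set exhausted by an increasing sequence `S` is covered by thin neighbourhoods of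
compact layers `L j ⊆ closure (S (k j))` of prescribed small measure. -/
lemma exists_compact_layers {X : Type*} [MetricSpace X] [ProperSpace X] [MeasurableSpace X]
    [BorelSpace X] (ν : Measure X) [IsFiniteMeasureOnCompacts ν] {K : Set X} (hK : IsCompact K)
    {S : ℕ → Set X} (hS : Monotone S) (hSU : ∀ x, ∃ k, x ∈ S k) {q : ℕ → ℝ≥0∞}
    (hq₀ : ν K < q 0) (hq : ∀ j, q j ≠ 0) {t : ℕ → ℝ} (ht : ∀ k, 0 < t k) (A : ℝ) :
    ∃ (k : ℕ → ℕ) (L : ℕ → Set X) (s : ℕ → ℝ), (∀ j, 0 < s j) ∧ (∀ j, s j ≤ t (k j)) ∧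
      (∀ j, L j ⊆ closure (S (k j))) ∧ (∀ j, ν (cthickening (A * s j) (L j)) ≤ q j) ∧
      K ⊆ ⋃ j, thickening (s j) (L j) := by
  have hlim : Tendsto (fun k => ν (K \ closure (S k))) atTop (𝓝 0) := by
    have h := tendsto_measure_iInter_atTop (μ := ν) (s := fun k => K \ closure (S k))
      (fun k => (hK.isClosed.measurableSet.diff isClosed_closure.measurableSet).nullMeasurableSet)
      (fun i j hij => sdiff_subset_sdiff_right (closure_mono (hS hij)))
      ⟨0, ((measure_mono sdiff_subset).trans_lt hK.measure_lt_top).ne⟩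
    have h0 : ⋂ k, K \ closure (S k) = ∅ := by
      ext x
      simp only [mem_iInter, Set.mem_sdiff, mem_empty_iff_false, iff_false, not_forall]
      obtain ⟨k, hk⟩ := hSU x
      exact ⟨k, fun h => h.2 (subset_closure hk)⟩
    rwa [h0, measure_empty] at h
  have hex : ∀ j, ∃ k, j ≤ k ∧ ν (K \ closure (S k)) < q (j + 1) := fun j =>
    ((eventually_ge_atTop j).and
      (hlim.eventually_lt_const (pos_iff_ne_zero.2 (hq (j + 1))))).exists
  choose k hk hkq using hex
  have hσ : ∀ (j : ℕ) (L : Set X), ∃ s : ℝ, 0 < s ∧ s ≤ t (k j) ∧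
      (IsCompact L → ν L < q j → ν (cthickening (A * s) L) ≤ q j) := by
    intro j L
    by_cases hL : IsCompact L ∧ ν L < q j
    · have h1 : Tendsto (fun s : ℝ => A * s) (𝓝 0) (𝓝 0) := by
        simpa using (continuous_const_mul A).tendsto (0 : ℝ)
      have h2 := ((tendsto_measure_cthickening_of_isCompact (μ := ν) hL.1).comp h1
        |>.eventually_lt_const hL.2)
      have h3 : ∀ᶠ s in 𝓝[>] (0 : ℝ), s ≤ t (k j) :=
        nhdsWithin_le_nhds (eventually_le_nhds (ht _))
      obtain ⟨s, ⟨hs1, hs2⟩, hs3⟩ :=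
        (((h2.filter_mono nhdsWithin_le_nhds).and h3).and self_mem_nhdsWithin).exists
      exact ⟨s, hs3, hs2, fun _ _ => hs1.le⟩
    · exact ⟨t (k j), ht _, le_rfl, fun h1 h2 => absurd ⟨h1, h2⟩ hL⟩
  choose σ hσ0 hσt hσν using hσ
  let F : ℕ → Set X := fun j => K ∩ closure (S (k j))
  let W : ℕ → Set X := fun j => Nat.rec (motive := fun _ => Set X) ∅
    (fun j V => V ∪ thickening (σ j (F j \ V)) (F j \ V)) j
  have hW : ∀ j, W (j + 1) = W j ∪ thickening (σ j (F j \ W j)) (F j \ W j) := fun j => rfl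
  have hWo : ∀ j, IsOpen (W j) := by
    intro j
    induction j with
    | zero => exact isOpen_empty
    | succ j ih => rw [hW]; exact ih.union isOpen_thickening
  have hFW : ∀ j, F j ⊆ W (j + 1) := fun j y hy => by
    rw [hW]
    by_cases hyW : y ∈ W j
    · exact Or.inl hyW
    · exact Or.inr (self_subset_thickening (hσ0 _ _) _ ⟨hy, hyW⟩)
  have hcomp : ∀ j, IsCompact (F j \ W j) := fun j =>
    (hK.inter_right isClosed_closure).diff (hWo j)
  have hsmall : ∀ j, ν (F j \ W j) < q j := by
    intro j
    cases j with
    | zero => exact (measure_mono (sdiff_subset.trans inter_subset_left)).trans_lt hq₀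
    | succ j =>
      refine (measure_mono ?_).trans_lt (hkq j)
      exact fun y hy => ⟨hy.1.1, fun hyc => hy.2 (hFW j ⟨hy.1.1, hyc⟩)⟩
  refine ⟨k, fun j => F j \ W j, fun j => σ j (F j \ W j), fun j => hσ0 _ _, fun j => hσt _ _,
    fun j => sdiff_subset.trans inter_subset_right,
    fun j => hσν _ _ (hcomp j) (hsmall j), fun y hy => ?_⟩
  obtain ⟨m, hm⟩ := hSU y
  have hyW : y ∈ W (m + 1) := hFW m ⟨hy, subset_closure (hS (hk m) hm)⟩
  have hWU : ∀ j, W j ⊆ ⋃ j, thickening (σ j (F j \ W j)) (F j \ W j) := by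
    intro j
    induction j with
    | zero => exact empty_subset _
    | succ j ih =>
      rw [hW]
      exact union_subset ih (subset_iUnion (fun j => thickening (σ j (F j \ W j)) (F j \ W j)) j)
  exact hWU (m + 1) hyW

lemma ENNReal.tsum_pow_le_two_pow_mul_tsum (g : ℕ → ℝ≥0∞) {n : ℕ} (hn : n ≠ 0) :
    (∑' j, g j) ^ n ≤ 2 ^ n * ∑' j, (2 ^ j * g j) ^ n := by
  have hsup : ∀ j, 2 ^ j * g j ≤ (∑' j, (2 ^ j * g j) ^ n) ^ (n : ℝ)⁻¹ := fun j => by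
    rw [ENNReal.le_rpow_inv_iff (by positivity), ENNReal.rpow_natCast]
    exact ENNReal.le_tsum j
  have h : ∑' j, g j ≤ 2 * (∑' j, (2 ^ j * g j) ^ n) ^ (n : ℝ)⁻¹ := by
    calc ∑' j, g j = ∑' j, 2⁻¹ ^ j * (2 ^ j * g j) := by
          refine tsum_congr fun j => ?_
          rw [← mul_assoc, ← mul_pow, ENNReal.inv_mul_cancel (by simp) (by simp), one_pow, one_mul]
      _ ≤ ∑' j : ℕ, 2⁻¹ ^ j * (∑' j, (2 ^ j * g j) ^ n) ^ (n : ℝ)⁻¹ := by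
          gcongr with j; exact hsup j
      _ = _ := by
          rw [ENNReal.tsum_mul_right, ENNReal.tsum_geometric, ENNReal.one_sub_inv_two, inv_inv]
  calc _ ≤ (2 * (∑' j, (2 ^ j * g j) ^ n) ^ (n : ℝ)⁻¹) ^ n := by gcongr
    _ = _ := by
      rw [mul_pow, ← ENNReal.rpow_natCast (_ ^ (n : ℝ)⁻¹) n, ← ENNReal.rpow_mul,
        inv_mul_cancel₀ (by positivity), ENNReal.rpow_one]

/-- A bound, independent of `f`, for a density that is admissible for all paths whose images
under `f` leave a given bounded set. -/
lemma exists_uniform_density {n : ℕ} (hn : n ≠ 0) {Q : EuclideanSpace ℝ (Fin n) → ℝ≥0∞}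
    (hQ : Measurable Q)
    (hQloc : ∀ K : Set (EuclideanSpace ℝ (Fin n)), IsCompact K → (∫⁻ y in K, Q y) < ∞)
    {K : Set (EuclideanSpace ℝ (Fin n))} (hK : IsCompact K) {δ : ℝ} (hδ : 0 < δ) :
    ∃ C : ℝ≥0∞, C ≠ ∞ ∧ ∀ (D : Set (EuclideanSpace ℝ (Fin n)))
      (f : EuclideanSpace ℝ (Fin n) → EuclideanSpace ℝ (Fin n)), IsOpen D → ContinuousOn f D →
      (∀ y, InvPoletsky n D f Q y) →
      ∃ ρ : EuclideanSpace ℝ (Fin n) → ℝ≥0∞, Measurable ρ ∧ ∫⁻ x, ρ x ^ n ≤ C ∧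
        ∀ γ : PathOn n, (∀ t ∈ Icc γ.a γ.b, γ.toFun t ∈ D) →
          ∀ u : EuclideanSpace ℝ (Fin n) → ℝ, LipschitzWith 1 u → {y | 0 ≤ u y ∧ u y ≤ δ} ⊆ K →
            u (f (γ.toFun γ.a)) ≤ 0 → 2 * δ ≤ u (f (γ.toFun γ.b)) →
            1 ≤ arcIntegral n ρ γ.toFun γ.a γ.b := by
  set ν : Measure (EuclideanSpace ℝ (Fin n)) := volume.withDensity fun y => Q y + 1 with hν
  have : IsFiniteMeasureOnCompacts ν := ⟨fun T hT => by
    rw [hν, withDensity_apply _ hT.measurableSet, lintegral_add_left hQ]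
    simpa using ⟨hQloc T hT, hT.measure_lt_top⟩⟩
  have hνK : ν K ≠ ∞ := hK.measure_lt_top.ne
  set c : ℝ≥0∞ := (ENNReal.ofReal δ)⁻¹ with hc
  have hδ0 : ENNReal.ofReal δ ≠ 0 := by simpa using hδ
  have hct : c ≠ ∞ := ENNReal.inv_ne_top.2 hδ0
  let q : ℕ → ℝ≥0∞ := fun j => (ν K + 1) * (2⁻¹ ^ j * 2⁻¹ ^ (j * n))
  have hqsum : ∑' j, (2 ^ j) ^ n * q j = (ν K + 1) * 2 := by
    have : ∀ j : ℕ, (2 ^ j) ^ n * q j = (ν K + 1) * 2⁻¹ ^ j := fun j => by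
      have h2 : ((2 : ℝ≥0∞) ^ j) ^ n * 2⁻¹ ^ (j * n) = 1 := by
        rw [← pow_mul, ← mul_pow, ENNReal.mul_inv_cancel (by simp) (by simp), one_pow]
      calc _ = (ν K + 1) * 2⁻¹ ^ j * (((2 : ℝ≥0∞) ^ j) ^ n * 2⁻¹ ^ (j * n)) := by
            simp only [q]; ring
        _ = _ := by rw [h2, mul_one]
    rw [tsum_congr this, ENNReal.tsum_mul_left, ENNReal.tsum_geometric, ENNReal.one_sub_inv_two,
      inv_inv]
  set O : ℝ≥0∞ := (overlapBound n : ℝ≥0∞) ^ (n + 1) with hO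
  have hOt : O ≠ ∞ := ENNReal.pow_ne_top (ENNReal.natCast_ne_top _)
  refine ⟨(2 * c) ^ n * (2 ^ n * (O * ((ν K + 1) * 2))), by finiteness, ?_⟩
  intro D f hD hf hP
  let S : ℕ → Set (EuclideanSpace ℝ (Fin n)) :=
    fun k => {y | ∀ r > 0, 2 * r < 1 / ((k : ℝ) + 1) → HasDensityAt n D f ν y r}
  have hSm : Monotone S := fun k l hkl y hy r hr hrl =>
    hy r hr (hrl.trans_le (one_div_le_one_div_of_le (by positivity) (by gcongr)))
  have hSU : ∀ y, ∃ k, y ∈ S k := fun y => by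
    obtain ⟨r₀, hr₀, h⟩ := (hP y).exists_hasDensityAt hn hQ hQloc
    obtain ⟨k, hk⟩ := exists_nat_one_div_lt hr₀
    exact ⟨k, fun r hr hr2 => h r hr (hr2.trans hk)⟩
  let t : ℕ → ℝ := fun k => min (1 / ((k : ℝ) + 1) / (4 * (n + 2))) (δ / (3 * (n + 2)))
  have ht : ∀ k, 0 < t k := fun k => by positivity
  obtain ⟨k, L, s, hs0, hst, hL, hLν, hcov⟩ := exists_compact_layers ν hK hSm hSU (q := q)
    (by simpa [q] using ENNReal.lt_add_right hνK one_ne_zero)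
    (fun j => by simp [q]) ht (2 * n + 5)
  have hdens := fun j => exists_density_of_uniform_radius hn hD hf ν (hL j) (hs0 j)
    (fun y hy => hy ((n + 2) * s j) (mul_pos (by positivity) (hs0 j)) (by
      have h1 : s j ≤ 1 / ((k j : ℝ) + 1) / (4 * (n + 2)) := (hst j).trans (min_le_left _ _)
      rw [le_div_iff₀ (by positivity)] at h1
      have h2 : (0 : ℝ) < (n + 2) * s j := mul_pos (by positivity) (hs0 j)
      linarith))
  choose ρ hρm hρI hρ using hdens
  refine ⟨fun x => ∑' j, (2 * c) * ρ j x, by fun_prop, ?_, ?_⟩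
  · calc ∫⁻ x, (∑' j, (2 * c) * ρ j x) ^ n
        ≤ ∫⁻ x, (2 * c) ^ n * (2 ^ n * ∑' j, (2 ^ j) ^ n * ρ j x ^ n) := by
          refine lintegral_mono fun x => ?_
          dsimp only
          rw [ENNReal.tsum_mul_left, mul_pow]
          gcongr
          refine (ENNReal.tsum_pow_le_two_pow_mul_tsum (fun j => ρ j x) hn).trans_eq ?_
          simp_rw [mul_pow]
      _ = (2 * c) ^ n * (2 ^ n * ∑' j, (2 ^ j) ^ n * ∫⁻ x, ρ j x ^ n) := by
          rw [lintegral_const_mul _ (by fun_prop), lintegral_const_mul _ (by fun_prop),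
            lintegral_tsum (fun j => by fun_prop)]
          congr 3
          ext j
          rw [lintegral_const_mul _ (by fun_prop)]
      _ ≤ (2 * c) ^ n * (2 ^ n * ∑' j, (2 ^ j) ^ n * (O * q j)) := by
          gcongr with j
          exact (hρI j).trans (by gcongr; exact hLν j)
      _ = _ := by
          rw [← hqsum, ← ENNReal.tsum_mul_left (a := O)]
          congr 3
          ext j
          ring
  · intro γ hγ u hu huK ha hb
    refine le_trans ?_ (tsum_arcIntegral_le (c := fun _ => 2 * c) hρm γ.cont)
    have hcont : ContinuousOn (fun τ => u (f (γ.toFun τ))) (Icc γ.a γ.b) :=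
      hu.continuous.comp_continuousOn (hf.comp γ.cont hγ)
    have hsub : Icc 0 δ ⊆ ⋃ j, u '' {y | y ∈ (fun t => f (γ.toFun t)) '' Icc γ.a γ.b ∧
        y ∈ thickening (s j) (L j) ∧ u y ≤ δ} := by
      intro v hv
      obtain ⟨τ, hτ, rfl⟩ := intermediate_value_Icc γ.hab hcont
        ⟨ha.trans hv.1, hv.2.trans (by linarith)⟩
      obtain ⟨j, hj⟩ := mem_iUnion.1 (hcov (huK hv))
      exact mem_iUnion.2 ⟨j, _, ⟨⟨τ, hτ, rfl⟩, hj, hv.2⟩, rfl⟩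
    have hvol : ENNReal.ofReal δ ≤ ∑' j, 2 * arcIntegral n (ρ j) γ.toFun γ.a γ.b := by
      calc ENNReal.ofReal δ = volume (Icc 0 δ) := by rw [Real.volume_Icc, sub_zero]
        _ ≤ _ := (measure_mono hsub).trans (measure_iUnion_le _)
        _ ≤ _ := ENNReal.tsum_le_tsum fun j => hρ j γ hγ u hu δ (by
            have h1 : s j ≤ δ / (3 * (n + 2)) := (hst j).trans (min_le_right _ _)
            rw [le_div_iff₀ (by positivity)] at h1
            linarith)
    calc (1 : ℝ≥0∞) = c * ENNReal.ofReal δ :=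
          (ENNReal.inv_mul_cancel hδ0 ENNReal.ofReal_ne_top).symm
      _ ≤ c * ∑' j, 2 * arcIntegral n (ρ j) γ.toFun γ.a γ.b := by gcongr
      _ = _ := by
        rw [← ENNReal.tsum_mul_left]
        congr 1
        ext j
        ring

lemma lintegral_rpow_Ioo_zero_one_ne_top {s : ℝ} (hs : -1 < s) :
    ∫⁻ t in Ioo (0 : ℝ) 1, ENNReal.ofReal (t ^ s) ≠ ∞ := by
  have h := (intervalIntegral.intervalIntegrable_rpow' (a := 0) (b := 1) hs).1
  have h2 := (h.mono_set Ioo_subset_Ioc_self).lintegral_lt_top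
  exact h2.ne

/-- Hölder's inequality on `(0, 1)` with a power weight. -/
lemma exists_lintegral_Ioo_pow_le {n : ℕ} (hn : 2 ≤ n) :
    ∃ C : ℝ≥0∞, C ≠ ∞ ∧ ∀ g : ℝ → ℝ≥0∞, Measurable g →
      (∫⁻ t in Ioo (0 : ℝ) 1, g t) ^ n ≤
        C * ∫⁻ t in Ioo (0 : ℝ) 1, ENNReal.ofReal (t ^ ((n : ℝ) - 3 / 2)) * g t ^ n := by
  have hn' : (2 : ℝ) ≤ n := by exact_mod_cast hn
  have hpq : (n : ℝ).HolderConjugate (n / (n - 1)) := by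
    simpa [Real.conjExponent] using Real.HolderConjugate.conjExponent (p := n) (by linarith)
  set α : ℝ := (n - 3 / 2) / n with hα
  set q : ℝ := n / (n - 1) with hq
  have hq0 : 0 < q := hpq.symm.pos
  have hαq : α * q < 1 := by
    rw [hα, hq, div_mul_div_comm, div_lt_one (by nlinarith)]
    nlinarith
  set C : ℝ≥0∞ := (∫⁻ t in Ioo (0 : ℝ) 1, ENNReal.ofReal (t ^ (-α * q))) ^ (1 / q) with hC
  refine ⟨C ^ n, ENNReal.pow_ne_top (ENNReal.rpow_ne_top_of_nonneg (by positivity)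
    (lintegral_rpow_Ioo_zero_one_ne_top (by linarith))), fun g hg => ?_⟩
  have h := ENNReal.lintegral_mul_le_Lp_mul_Lq (volume.restrict (Ioo (0 : ℝ) 1)) hpq
    (f := fun t => ENNReal.ofReal (t ^ α) * g t) (g := fun t => ENNReal.ofReal (t ^ (-α)))
    (by fun_prop) (by fun_prop)
  have e1 : ∫⁻ t in Ioo (0 : ℝ) 1,
      ((fun t => ENNReal.ofReal (t ^ α) * g t) * fun t => ENNReal.ofReal (t ^ (-α))) t =
      ∫⁻ t in Ioo (0 : ℝ) 1, g t := by
    refine setLIntegral_congr_fun measurableSet_Ioo fun t ht => ?_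
    have : ENNReal.ofReal (t ^ α) * ENNReal.ofReal (t ^ (-α)) = 1 := by
      rw [← ENNReal.ofReal_mul (Real.rpow_nonneg ht.1.le _), ← Real.rpow_add ht.1]
      simp
    calc _ = ENNReal.ofReal (t ^ α) * ENNReal.ofReal (t ^ (-α)) * g t := by
          simp only [Pi.mul_apply]; ring
      _ = _ := by rw [this, one_mul]
  have e2 : ∫⁻ t in Ioo (0 : ℝ) 1, (ENNReal.ofReal (t ^ α) * g t) ^ (n : ℝ) =
      ∫⁻ t in Ioo (0 : ℝ) 1, ENNReal.ofReal (t ^ ((n : ℝ) - 3 / 2)) * g t ^ n := by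
    refine setLIntegral_congr_fun measurableSet_Ioo fun t ht => ?_
    rw [ENNReal.mul_rpow_of_nonneg _ _ (by positivity), ENNReal.rpow_natCast (g t),
      ENNReal.ofReal_rpow_of_nonneg (Real.rpow_nonneg ht.1.le _) (by positivity),
      ← Real.rpow_mul ht.1.le, hα, div_mul_cancel₀ _ (by positivity)]
  have e3 : ∫⁻ t in Ioo (0 : ℝ) 1, (ENNReal.ofReal (t ^ (-α))) ^ q =
      ∫⁻ t in Ioo (0 : ℝ) 1, ENNReal.ofReal (t ^ (-α * q)) := by
    refine setLIntegral_congr_fun measurableSet_Ioo fun t ht => ?_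
    rw [ENNReal.ofReal_rpow_of_nonneg (Real.rpow_nonneg ht.1.le _) hq0.le,
      ← Real.rpow_mul ht.1.le]
  rw [e1, e2, e3, ← hC] at h
  calc _ ≤ ((∫⁻ t in Ioo (0 : ℝ) 1, ENNReal.ofReal (t ^ ((n : ℝ) - 3 / 2)) * g t ^ n) ^
        (1 / (n : ℝ)) * C) ^ n := by gcongr
    _ = _ := by
      rw [mul_pow, mul_comm, ← ENNReal.rpow_natCast (_ ^ (1 / (n : ℝ))) n, ← ENNReal.rpow_mul,
        one_div_mul_cancel (by positivity), ENNReal.rpow_one]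

/-- The polygonal path from `p` through `z` to `q`, on `[0, 2]`. -/
def twoSegmentPath {n : ℕ} (p z q : EuclideanSpace ℝ (Fin n)) (t : ℝ) :
    EuclideanSpace ℝ (Fin n) :=
  z + max (1 - t) 0 • (p - z) + max (t - 1) 0 • (q - z)

lemma lipschitzWith_twoSegmentPath {n : ℕ} {p z q : EuclideanSpace ℝ (Fin n)} {K : ℝ≥0}
    (hp : dist p z ≤ K) (hq : dist q z ≤ K) : LipschitzWith (2 * K) (twoSegmentPath p z q) := by
  refine LipschitzWith.of_dist_le_mul fun s t => ?_
  rw [dist_eq_norm] at *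
  have e : twoSegmentPath p z q s - twoSegmentPath p z q t =
      (max (1 - s) 0 - max (1 - t) 0) • (p - z) + (max (s - 1) 0 - max (t - 1) 0) • (q - z) := by
    simp only [twoSegmentPath]; module
  have h1 : |max (1 - s) 0 - max (1 - t) 0| ≤ |s - t| := by
    refine (abs_max_sub_max_le_abs _ _ _).trans_eq ?_
    rw [abs_sub_comm]; congr 1; ring
  have h2 : |max (s - 1) 0 - max (t - 1) 0| ≤ |s - t| := by
    refine (abs_max_sub_max_le_abs _ _ _).trans_eq ?_
    congr 1; ring
  rw [e, Real.dist_eq]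
  calc _ ≤ |max (1 - s) 0 - max (1 - t) 0| * ‖p - z‖ + |max (s - 1) 0 - max (t - 1) 0| * ‖q - z‖ :=
        (norm_add_le _ _).trans_eq (by simp only [norm_smul, Real.norm_eq_abs])
    _ ≤ |s - t| * K + |s - t| * K := by gcongr
    _ = _ := by push_cast; ring

lemma twoSegmentPath_mem {n : ℕ} {p z q : EuclideanSpace ℝ (Fin n)}
    {s : Set (EuclideanSpace ℝ (Fin n))} (hs : Convex ℝ s) (hp : p ∈ s) (hz : z ∈ s) (hq : q ∈ s)
    {t : ℝ} (ht : t ∈ Icc (0 : ℝ) 2) : twoSegmentPath p z q t ∈ s := by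
  rcases le_total t 1 with h | h
  · rw [twoSegmentPath, max_eq_left (by linarith), max_eq_right (by linarith)]
    have := hs.add_smul_sub_mem hz hp (t := 1 - t) ⟨by linarith, by linarith [ht.1]⟩
    simpa using this
  · rw [twoSegmentPath, max_eq_right (by linarith), max_eq_left (by linarith)]
    have := hs.add_smul_sub_mem hz hq (t := t - 1) ⟨by linarith, by linarith [ht.2]⟩
    simpa using this

lemma arcIntegral_twoSegmentPath_le {n : ℕ} {p z q : EuclideanSpace ℝ (Fin n)} {K : ℝ≥0}
    (hp : dist p z ≤ K) (hq : dist q z ≤ K) (ρ : EuclideanSpace ℝ (Fin n) → ℝ≥0∞) :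
    arcIntegral n ρ (twoSegmentPath p z q) 0 2 ≤
      2 * K * ((∫⁻ t in Ioo (0 : ℝ) 1, ρ (p + t • (z - p))) +
        ∫⁻ t in Ioo (0 : ℝ) 1, ρ (q + t • (z - q))) := by
  refine (arcIntegral_le_of_lipschitz (lipschitzWith_twoSegmentPath hp hq) (by norm_num)).trans ?_
  push_cast
  gcongr
  have e1 : ∫⁻ t in Icc (0 : ℝ) 1, ρ (twoSegmentPath p z q t) =
      ∫⁻ t in Ioo (0 : ℝ) 1, ρ (p + t • (z - p)) := by
    rw [setLIntegral_congr Ioo_ae_eq_Icc.symm]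
    refine setLIntegral_congr_fun measurableSet_Ioo fun t ht => ?_
    rw [twoSegmentPath, max_eq_left (by linarith [ht.2]), max_eq_right (by linarith [ht.2])]
    congr 1; module
  have e2 : ∫⁻ t in Icc (1 : ℝ) 2, ρ (twoSegmentPath p z q t) =
      ∫⁻ t in Ioo (0 : ℝ) 1, ρ (q + t • (z - q)) := by
    rw [setLIntegral_congr Ioo_ae_eq_Icc.symm, ← lintegral_indicator measurableSet_Ioo,
      ← lintegral_sub_left_eq_self _ (2 : ℝ), ← lintegral_indicator measurableSet_Ioo]
    refine lintegral_congr fun t => ?_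
    by_cases ht : t ∈ Ioo (0 : ℝ) 1
    · rw [indicator_of_mem ht, indicator_of_mem
          (show 2 - t ∈ Ioo (1 : ℝ) 2 from ⟨by linarith [ht.2], by linarith [ht.1]⟩),
        twoSegmentPath, max_eq_right (by linarith [ht.2]), max_eq_left (by linarith [ht.2])]
      congr 1; module
    · rw [indicator_of_notMem ht, indicator_of_notMem]
      exact fun h => ht ⟨by linarith [h.2], by linarith [h.1]⟩
  rw [← e1, ← e2, ← Icc_union_Icc_eq_Icc (zero_le_one' ℝ) one_le_two]
  exact lintegral_union_le _ _ _

lemma exists_norm_eq_one_inner_nonneg {n : ℕ} (hn : 2 ≤ n) (v w : EuclideanSpace ℝ (Fin n)) :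
    ∃ e : EuclideanSpace ℝ (Fin n), ‖e‖ = 1 ∧ 0 ≤ inner ℝ e v ∧ 0 ≤ inner ℝ e w := by
  have hlt : (Submodule.span ℝ {v}) ≠ ⊤ := by
    intro h
    have h1 := finrank_span_le_card (R := ℝ) ({v} : Set (EuclideanSpace ℝ (Fin n)))
    rw [h, finrank_top, finrank_euclideanSpace_fin] at h1
    simp at h1
    omega
  have hne : (Submodule.span ℝ {v})ᗮ ≠ ⊥ := by
    rwa [Ne, Submodule.orthogonal_eq_bot_iff]
  obtain ⟨e, he, he0⟩ := Submodule.exists_mem_ne_zero_of_ne_bot hne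
  have hev : inner ℝ e v = 0 := by
    rw [real_inner_comm]; exact he v (Submodule.mem_span_singleton_self v)
  have hpos : 0 < ‖e‖ := norm_pos_iff.2 he0
  rcases le_total 0 (inner ℝ e w) with h | h
  · refine ⟨‖e‖⁻¹ • e, by simp [norm_smul, hpos.ne'], ?_, ?_⟩
    · rw [real_inner_smul_left, hev, mul_zero]
    · rw [real_inner_smul_left]; positivity
  · refine ⟨-(‖e‖⁻¹ • e), by simp [norm_smul, hpos.ne'], ?_, ?_⟩
    · rw [inner_neg_left, real_inner_smul_left, hev, mul_zero, neg_zero]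
    · rw [inner_neg_left, real_inner_smul_left, ← mul_neg]
      exact mul_nonneg (by positivity) (by linarith)

/-- A neighbourhood of the sphere of radius `r` about `x₀` of relative width `6 t`. -/
def sphereShell {n : ℕ} (x₀ : EuclideanSpace ℝ (Fin n)) (r t : ℝ) :
    Set (EuclideanSpace ℝ (Fin n)) :=
  {w | |dist w x₀ - r| ≤ 6 * r * t ∧ r ≤ 3 * dist w x₀ ∧ dist w x₀ ≤ 5 * r}

lemma add_smul_sub_mem_sphereShell {n : ℕ} {x₀ p z e : EuclideanSpace ℝ (Fin n)} {r t : ℝ}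
    (hr : 0 < r) (hp : dist p x₀ = r) (hz : dist z x₀ ≤ 5 * r) (he : ‖e‖ = 1)
    (hep : 0 ≤ inner ℝ e (p - x₀)) (hez : 3 * r ≤ inner ℝ e (z - x₀)) (ht : t ∈ Ioo (0 : ℝ) 1) :
    p + t • (z - p) ∈ sphereShell x₀ r t := by
  obtain ⟨ht0, ht1⟩ := ht
  rw [dist_eq_norm] at hp hz
  have e1 : p + t • (z - p) - x₀ = (1 - t) • (p - x₀) + t • (z - x₀) := by module
  have e2 : p + t • (z - p) - x₀ = (p - x₀) + t • ((z - x₀) - (p - x₀)) := by module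
  have hn1 : ‖(1 - t) • (p - x₀)‖ = (1 - t) * r := by
    rw [norm_smul, hp, Real.norm_of_nonneg (by linarith)]
  have hn2 : ‖t • (z - x₀)‖ ≤ t * (5 * r) := by
    rw [norm_smul, Real.norm_of_nonneg ht0.le]; gcongr
  have hn3 : ‖t • ((z - x₀) - (p - x₀))‖ ≤ t * (6 * r) := by
    rw [norm_smul, Real.norm_of_nonneg ht0.le]
    gcongr
    exact (norm_sub_le _ _).trans (by linarith)
  refine ⟨?_, ?_, ?_⟩
  · rw [dist_eq_norm, ← hp, e2]
    refine (abs_norm_sub_norm_le _ _).trans ?_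
    rw [add_sub_cancel_left, hp]
    linarith
  · rw [dist_eq_norm, e1]
    have h1 : inner ℝ e ((1 - t) • (p - x₀) + t • (z - x₀)) ≤
        ‖(1 - t) • (p - x₀) + t • (z - x₀)‖ := by
      simpa [he] using real_inner_le_norm e ((1 - t) • (p - x₀) + t • (z - x₀))
    rw [inner_add_right, real_inner_smul_right, real_inner_smul_right] at h1
    have h2 : 0 ≤ (1 - t) * inner ℝ e (p - x₀) := mul_nonneg (by linarith) hep
    have h3 : t * (3 * r) ≤ t * inner ℝ e (z - x₀) := by gcongr
    have h4 : (1 - t) * r - t * (5 * r) ≤ ‖(1 - t) • (p - x₀) + t • (z - x₀)‖ := by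
      have := norm_sub_le ((1 - t) • (p - x₀) + t • (z - x₀)) (t • (z - x₀))
      rw [add_sub_cancel_right, hn1] at this
      linarith
    nlinarith
  · rw [dist_eq_norm, e1]
    refine (norm_add_le _ _).trans ?_
    rw [hn1]
    nlinarith

lemma isClosed_setOf_mem_sphereShell {n : ℕ} (x₀ : EuclideanSpace ℝ (Fin n)) :
    IsClosed {x : ℝ × ℝ × EuclideanSpace ℝ (Fin n) | x.2.2 ∈ sphereShell x₀ x.1 x.2.1} := by
  simp only [sphereShell, Set.ofPred_and]
  exact (isClosed_le (by fun_prop) (by fun_prop)).inter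
    ((isClosed_le (by fun_prop) (by fun_prop)).inter (isClosed_le (by fun_prop) (by fun_prop)))

lemma measurableSet_sphereShell {n : ℕ} (x₀ : EuclideanSpace ℝ (Fin n)) (r t : ℝ) :
    MeasurableSet (sphereShell x₀ r t) :=
  ((isClosed_setOf_mem_sphereShell x₀).preimage
    (f := fun w => (r, t, w)) (by fun_prop)).measurableSet

lemma lintegral_add_smul_sub {n : ℕ} (p : EuclideanSpace ℝ (Fin n)) {t : ℝ} (ht : 0 < t)
    {h : EuclideanSpace ℝ (Fin n) → ℝ≥0∞} (hh : Measurable h) :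
    ∫⁻ z, h (p + t • (z - p)) = ENNReal.ofReal (t ^ (-(n : ℝ))) * ∫⁻ w, h w := by
  have h1 := Measure.map_addHaar_smul (volume : Measure (EuclideanSpace ℝ (Fin n))) ht.ne'
  calc ∫⁻ z, h (p + t • (z - p)) = ∫⁻ z, h (t • z + (p - t • p)) := by
        refine lintegral_congr fun z => ?_
        congr 1; module
    _ = ∫⁻ z, h (z + (p - t • p)) ∂(Measure.map (t • ·) volume) := by
        rw [lintegral_map (by fun_prop) (by fun_prop)]
    _ = _ := by
        rw [h1, lintegral_smul_measure, lintegral_add_right_eq_self, finrank_euclideanSpace_fin,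
          abs_of_pos (by positivity), Real.rpow_neg ht.le, Real.rpow_natCast, smul_eq_mul]

lemma ENNReal.add_pow_le_two_pow_mul (a b : ℝ≥0∞) (n : ℕ) :
    (a + b) ^ n ≤ 2 ^ n * (a ^ n + b ^ n) := by
  calc (a + b) ^ n ≤ (2 * max a b) ^ n := by
        rw [two_mul]; gcongr <;> simp
    _ = 2 ^ n * (max a b) ^ n := mul_pow _ _ _
    _ ≤ _ := by
      gcongr
      rcases le_total a b with h | h
      · rw [max_eq_right h]; exact le_add_self
      · rw [max_eq_left h]; exact le_self_add

lemma setLIntegral_segment_pow_le {n : ℕ} {x₀ p e : EuclideanSpace ℝ (Fin n)} {r : ℝ}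
    (hr : 0 < r) (hp : dist p x₀ = r) (he : ‖e‖ = 1) (hep : 0 ≤ inner ℝ e (p - x₀))
    {Z : Set (EuclideanSpace ℝ (Fin n))} (hZm : MeasurableSet Z)
    (hZ : ∀ z ∈ Z, dist z x₀ ≤ 5 * r ∧ 3 * r ≤ inner ℝ e (z - x₀))
    {ρ : EuclideanSpace ℝ (Fin n) → ℝ≥0∞} (hρ : Measurable ρ) :
    ∫⁻ z in Z, ∫⁻ t in Ioo (0 : ℝ) 1,
        ENNReal.ofReal (t ^ ((n : ℝ) - 3 / 2)) * ρ (p + t • (z - p)) ^ n ≤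
      ∫⁻ t in Ioo (0 : ℝ) 1,
        ENNReal.ofReal (t ^ (-(3 / 2) : ℝ)) * ∫⁻ w in sphereShell x₀ r t, ρ w ^ n := by
  have hm : Measurable fun x : EuclideanSpace ℝ (Fin n) × ℝ =>
      ENNReal.ofReal (x.2 ^ ((n : ℝ) - 3 / 2)) * ρ (p + x.2 • (x.1 - p)) ^ n := by fun_prop
  rw [lintegral_lintegral_swap hm.aemeasurable]
  refine setLIntegral_mono' measurableSet_Ioo fun t ht => ?_
  rw [lintegral_const_mul _ (by fun_prop)]
  have h1 : ∫⁻ z in Z, ρ (p + t • (z - p)) ^ n ≤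
      ENNReal.ofReal (t ^ (-(n : ℝ))) * ∫⁻ w in sphereShell x₀ r t, ρ w ^ n := by
    rw [← lintegral_indicator hZm, ← lintegral_indicator (measurableSet_sphereShell x₀ r t),
      ← lintegral_add_smul_sub p ht.1
        ((hρ.pow_const n).indicator (measurableSet_sphereShell x₀ r t))]
    refine lintegral_mono fun z => ?_
    by_cases hz : z ∈ Z
    · rw [indicator_of_mem hz, indicator_of_mem
        (add_smul_sub_mem_sphereShell hr hp (hZ z hz).1 he hep (hZ z hz).2 ht)]
    · rw [indicator_of_notMem hz]
      exact zero_le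
  calc _ ≤ ENNReal.ofReal (t ^ ((n : ℝ) - 3 / 2)) * (ENNReal.ofReal (t ^ (-(n : ℝ))) *
        ∫⁻ w in sphereShell x₀ r t, ρ w ^ n) := by gcongr
    _ = _ := by
      rw [← mul_assoc, ← ENNReal.ofReal_mul (Real.rpow_nonneg ht.1.le _), ← Real.rpow_add ht.1]
      congr 3; ring

/-- If all two-segment paths joining two points of a sphere are long for `ρ`, then `ρ` is large
near the sphere. -/
lemma exists_volume_le_lintegral_sphereShell {n : ℕ} (hn : 2 ≤ n) :
    ∃ C : ℝ≥0∞, C ≠ ∞ ∧ ∀ (ρ : EuclideanSpace ℝ (Fin n) → ℝ≥0∞), Measurable ρ →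
      ∀ (x₀ p q : EuclideanSpace ℝ (Fin n)) (r : ℝ), 0 < r → dist p x₀ = r → dist q x₀ = r →
      (∀ z, dist z x₀ ≤ 5 * r → 1 ≤ arcIntegral n ρ (twoSegmentPath p z q) 0 2) →
      volume (ball (0 : EuclideanSpace ℝ (Fin n)) 1) ≤ C * ∫⁻ t in Ioo (0 : ℝ) 1,
        ENNReal.ofReal (t ^ (-(3 / 2) : ℝ)) * ∫⁻ w in sphereShell x₀ r t, ρ w ^ n := by
  obtain ⟨c, hc, hH⟩ := exists_lintegral_Ioo_pow_le hn
  refine ⟨12 ^ n * 2 ^ n * c * 2, by finiteness, fun ρ hρ x₀ p q r hr hp hq h => ?_⟩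
  obtain ⟨e, he, hep, heq⟩ := exists_norm_eq_one_inner_nonneg hn (p - x₀) (q - x₀)
  set Z := ball (x₀ + (4 * r) • e) r with hZdef
  have hZ : ∀ z ∈ Z, dist z x₀ ≤ 5 * r ∧ 3 * r ≤ inner ℝ e (z - x₀) := by
    intro z hz
    have hz' : ‖z - (x₀ + (4 * r) • e)‖ < r := by rw [← dist_eq_norm]; exact hz
    have e1 : z - x₀ = (4 * r) • e + (z - (x₀ + (4 * r) • e)) := by module
    constructor
    · rw [dist_eq_norm, e1]
      refine (norm_add_le _ _).trans ?_
      rw [norm_smul, he, Real.norm_of_nonneg (by positivity)]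
      linarith
    · rw [e1, inner_add_right, real_inner_smul_right, real_inner_self_eq_norm_sq, he]
      have := abs_le.1 (abs_real_inner_le_norm e (z - (x₀ + (4 * r) • e)))
      rw [he, one_mul] at this
      linarith [this.1]
  set J := ∫⁻ t in Ioo (0 : ℝ) 1,
    ENNReal.ofReal (t ^ (-(3 / 2) : ℝ)) * ∫⁻ w in sphereShell x₀ r t, ρ w ^ n with hJ
  let B : EuclideanSpace ℝ (Fin n) → EuclideanSpace ℝ (Fin n) → ℝ≥0∞ := fun p z =>
    ∫⁻ t in Ioo (0 : ℝ) 1, ENNReal.ofReal (t ^ ((n : ℝ) - 3 / 2)) * ρ (p + t • (z - p)) ^ n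
  have hBm : ∀ p, Measurable (B p) := fun p => Measurable.lintegral_prod_right' (f := fun x :
    EuclideanSpace ℝ (Fin n) × ℝ =>
      ENNReal.ofReal (x.2 ^ ((n : ℝ) - 3 / 2)) * ρ (p + x.2 • (x.1 - p)) ^ n) (by fun_prop)
  have hp' : ∫⁻ z in Z, B p z ≤ J :=
    setLIntegral_segment_pow_le hr hp he hep measurableSet_ball hZ hρ
  have hq' : ∫⁻ z in Z, B q z ≤ J :=
    setLIntegral_segment_pow_le hr hq he heq measurableSet_ball hZ hρ
  have hlow : ∀ z ∈ Z, 1 ≤ (12 * ENNReal.ofReal r) ^ n * (2 ^ n * c) * (B p z + B q z) := by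
    intro z hz
    have hd : ∀ p, dist p x₀ = r → dist p z ≤ (6 * r).toNNReal := fun p hp => by
      rw [Real.coe_toNNReal _ (by positivity)]
      have := dist_triangle_right p z x₀
      linarith [(hZ z hz).1]
    have h1 := (h z (hZ z hz).1).trans (arcIntegral_twoSegmentPath_le (hd p hp) (hd q hq) ρ)
    have e1 : (2 * ((6 * r).toNNReal : ℝ≥0∞)) = 12 * ENNReal.ofReal r := by
      change 2 * ENNReal.ofReal (6 * r) = _
      rw [ENNReal.ofReal_mul (by norm_num), ENNReal.ofReal_ofNat, ← mul_assoc]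
      norm_num
    rw [e1] at h1
    calc (1 : ℝ≥0∞) = 1 ^ n := (one_pow n).symm
      _ ≤ (12 * ENNReal.ofReal r * ((∫⁻ t in Ioo (0 : ℝ) 1, ρ (p + t • (z - p))) +
        ∫⁻ t in Ioo (0 : ℝ) 1, ρ (q + t • (z - q)))) ^ n := by gcongr
      _ ≤ (12 * ENNReal.ofReal r) ^ n * (2 ^ n * ((∫⁻ t in Ioo (0 : ℝ) 1, ρ (p + t • (z - p))) ^ n +
        (∫⁻ t in Ioo (0 : ℝ) 1, ρ (q + t • (z - q))) ^ n)) := by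
          rw [mul_pow]; gcongr; exact ENNReal.add_pow_le_two_pow_mul _ _ _
      _ ≤ (12 * ENNReal.ofReal r) ^ n * (2 ^ n * (c * B p z + c * B q z)) := by
          gcongr
          · exact hH _ (by fun_prop)
          · exact hH _ (by fun_prop)
      _ = _ := by ring
  have hr0 : ENNReal.ofReal r ^ n ≠ 0 := pow_ne_zero _ (by simpa using hr)
  have hrt : ENNReal.ofReal r ^ n ≠ ∞ := ENNReal.pow_ne_top ENNReal.ofReal_ne_top
  have hvol : volume Z = ENNReal.ofReal r ^ n * volume (ball (0 : EuclideanSpace ℝ (Fin n)) 1) := by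
    rw [hZdef, Measure.addHaar_ball_of_pos _ _ hr, finrank_euclideanSpace_fin,
      ENNReal.ofReal_pow hr.le]
  have hmain : ENNReal.ofReal r ^ n * volume (ball (0 : EuclideanSpace ℝ (Fin n)) 1) ≤
      ENNReal.ofReal r ^ n * (12 ^ n * 2 ^ n * c * 2 * J) := by
    calc _ = ∫⁻ z in Z, 1 := by rw [← hvol]; simp
      _ ≤ ∫⁻ z in Z, (12 * ENNReal.ofReal r) ^ n * (2 ^ n * c) * (B p z + B q z) :=
          setLIntegral_mono' measurableSet_ball hlow
      _ = (12 * ENNReal.ofReal r) ^ n * (2 ^ n * c) *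
          ((∫⁻ z in Z, B p z) + ∫⁻ z in Z, B q z) := by
        rw [lintegral_const_mul _ (by fun_prop), lintegral_add_left (hBm p)]
      _ ≤ (12 * ENNReal.ofReal r) ^ n * (2 ^ n * c) * (J + J) := by gcongr
      _ = _ := by ring
  exact (ENNReal.mul_le_mul_iff_right hr0 hrt).1 hmain

lemma setLIntegral_ofReal_inv {δ d : ℝ} (hδ : 0 < δ) (hd : δ < d) :
    ∫⁻ r in Ioo δ d, ENNReal.ofReal r⁻¹ = ENNReal.ofReal (Real.log (d / δ)) := by
  have hintg : IntervalIntegrable (fun r : ℝ => r⁻¹) volume δ d :=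
    intervalIntegral.intervalIntegrable_inv (fun r hr => by
      rw [uIcc_of_le hd.le] at hr
      linarith [hr.1]) continuousOn_id
  rw [setLIntegral_congr Ioo_ae_eq_Ioc, ← integral_inv_of_pos hδ (hδ.trans hd),
    intervalIntegral.integral_of_le hd.le, ofReal_integral_eq_lintegral_ofReal hintg.1]
  exact (ae_restrict_mem measurableSet_Ioc).mono fun r hr => inv_nonneg.2 (hδ.trans hr.1).le

lemma lintegral_inv_sphereShell_le {n : ℕ} (x₀ w : EuclideanSpace ℝ (Fin n)) {t : ℝ} (ht : 0 ≤ t)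
    {δ d : ℝ} (hδ : 0 < δ) :
    ∫⁻ r in Ioo δ d, ENNReal.ofReal r⁻¹ * (sphereShell x₀ r t).indicator 1 w ≤
      ENNReal.ofReal (180 * t) := by
  set R := dist w x₀ with hR
  rcases (dist_nonneg (x := w) (y := x₀)).eq_or_lt with h0 | h0
  · refine (le_of_eq ?_).trans zero_le
    refine (setLIntegral_congr_fun measurableSet_Ioo fun r hr => ?_).trans lintegral_zero
    rw [indicator_of_notMem, mul_zero]
    rintro ⟨-, h2, -⟩
    rw [← h0] at h2
    linarith [hr.1]
  have hRpos : 0 < R := h0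
  calc _ ≤ ∫⁻ r in Ioo δ d, (closedBall R (18 * R * t)).indicator
        (fun _ => ENNReal.ofReal (5 / R)) r := by
        refine setLIntegral_mono' measurableSet_Ioo fun r hr => ?_
        have hrpos : 0 < r := hδ.trans hr.1
        by_cases hw : w ∈ sphereShell x₀ r t
        · rw [indicator_of_mem hw, indicator_of_mem]
          all_goals obtain ⟨h1, h2, h3⟩ := hw
          · rw [Pi.one_apply, mul_one]
            refine ENNReal.ofReal_le_ofReal ?_
            rw [inv_le_comm₀ hrpos (by positivity), inv_div]
            linarith
          · rw [mem_closedBall, Real.dist_eq, abs_sub_comm]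
            refine h1.trans (mul_le_mul_of_nonneg_right ?_ ht)
            linarith
        · rw [indicator_of_notMem hw, mul_zero]
          exact zero_le
    _ ≤ ∫⁻ r, (closedBall R (18 * R * t)).indicator (fun _ => ENNReal.ofReal (5 / R)) r :=
        setLIntegral_le_lintegral _ _
    _ = ENNReal.ofReal (180 * t) := by
        rw [lintegral_indicator measurableSet_closedBall, setLIntegral_const,
          Real.volume_closedBall, ← ENNReal.ofReal_mul (by positivity)]
        congr 1
        field_simp
        ring

/-- A lower bound of Loewner type. -/
lemma exists_log_le_lintegral_pow {n : ℕ} (hn : 2 ≤ n) :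
    ∃ C : ℝ≥0∞, C ≠ ∞ ∧ ∀ (ρ : EuclideanSpace ℝ (Fin n) → ℝ≥0∞), Measurable ρ →
      ∀ (x₀ : EuclideanSpace ℝ (Fin n)) (δ d : ℝ), 0 < δ → δ < d →
      (∀ r ∈ Ioo δ d, ∃ p q, dist p x₀ = r ∧ dist q x₀ = r ∧
        ∀ z, dist z x₀ ≤ 5 * r → 1 ≤ arcIntegral n ρ (twoSegmentPath p z q) 0 2) →
      ENNReal.ofReal (Real.log (d / δ)) ≤ C * ∫⁻ x, ρ x ^ n := by
  obtain ⟨C, hC, hlow⟩ := exists_volume_le_lintegral_sphereShell hn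
  set ω := volume (ball (0 : EuclideanSpace ℝ (Fin n)) 1) with hω
  have hω0 : ω ≠ 0 := (measure_ball_pos _ _ one_pos).ne'
  have hωt : ω ≠ ∞ := measure_ball_lt_top.ne
  set I := ∫⁻ t in Ioo (0 : ℝ) 1, ENNReal.ofReal (t ^ (-(1 / 2) : ℝ)) with hI
  have hIt : I ≠ ∞ := lintegral_rpow_Ioo_zero_one_ne_top (by norm_num)
  refine ⟨ω⁻¹ * (C * (180 * I)), by finiteness, fun ρ hρ x₀ δ d hδ hd h => ?_⟩
  have hmW : Measurable fun x : ℝ × ℝ × EuclideanSpace ℝ (Fin n) =>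
      (sphereShell x₀ x.1 x.2.1).indicator (1 : EuclideanSpace ℝ (Fin n) → ℝ≥0∞) x.2.2 :=
    (measurable_const (a := (1 : ℝ≥0∞))).indicator
      (isClosed_setOf_mem_sphereShell x₀).measurableSet
  have key : ω * ENNReal.ofReal (Real.log (d / δ)) ≤ C * (180 * I * ∫⁻ x, ρ x ^ n) := by
    have hmF : Measurable fun x : ℝ × ℝ × EuclideanSpace ℝ (Fin n) =>
        ENNReal.ofReal x.1⁻¹ * (ENNReal.ofReal (x.2.1 ^ (-(3 / 2) : ℝ)) *
          ((sphereShell x₀ x.1 x.2.1).indicator 1 x.2.2 * ρ x.2.2 ^ n)) := by fun_prop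
    calc ω * ENNReal.ofReal (Real.log (d / δ)) = ∫⁻ r in Ioo δ d, ω * ENNReal.ofReal r⁻¹ := by
          rw [lintegral_const_mul _ (by fun_prop), setLIntegral_ofReal_inv hδ hd]
      _ ≤ ∫⁻ r in Ioo δ d, C * ∫⁻ t in Ioo (0 : ℝ) 1, ∫⁻ w, ENNReal.ofReal r⁻¹ *
          (ENNReal.ofReal (t ^ (-(3 / 2) : ℝ)) *
            ((sphereShell x₀ r t).indicator 1 w * ρ w ^ n)) := by
          refine setLIntegral_mono' measurableSet_Ioo fun r hr => ?_
          obtain ⟨p, q, hp, hq, hz⟩ := h r hr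
          have h1 := hlow ρ hρ x₀ p q r (hδ.trans hr.1) hp hq hz
          calc ω * ENNReal.ofReal r⁻¹ ≤ _ := mul_le_mul_left h1 _
            _ = C * (ENNReal.ofReal r⁻¹ * ∫⁻ t in Ioo (0 : ℝ) 1,
              ENNReal.ofReal (t ^ (-(3 / 2) : ℝ)) * ∫⁻ w in sphereShell x₀ r t, ρ w ^ n) := by ring
            _ = _ := by
              rw [← lintegral_const_mul' _ _ ENNReal.ofReal_ne_top]
              congr 1
              refine lintegral_congr fun t => ?_
              rw [lintegral_const_mul' _ _ ENNReal.ofReal_ne_top,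
                lintegral_const_mul' _ _ ENNReal.ofReal_ne_top,
                ← lintegral_indicator (measurableSet_sphereShell x₀ r t)]
              congr 3
              ext w
              by_cases hw : w ∈ sphereShell x₀ r t <;> simp [hw]
      _ = C * ∫⁻ t in Ioo (0 : ℝ) 1, ∫⁻ r in Ioo δ d, ∫⁻ w, ENNReal.ofReal r⁻¹ *
          (ENNReal.ofReal (t ^ (-(3 / 2) : ℝ)) *
            ((sphereShell x₀ r t).indicator 1 w * ρ w ^ n)) := by
          rw [lintegral_const_mul' _ _ hC, lintegral_lintegral_swap]
          refine Measurable.aemeasurable ?_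
          exact Measurable.lintegral_prod_right' (f := fun y : (ℝ × ℝ) × EuclideanSpace ℝ (Fin n) =>
            ENNReal.ofReal y.1.1⁻¹ * (ENNReal.ofReal (y.1.2 ^ (-(3 / 2) : ℝ)) *
              ((sphereShell x₀ y.1.1 y.1.2).indicator 1 y.2 * ρ y.2 ^ n)))
            (hmF.comp (g := fun x => _) (f := fun y : (ℝ × ℝ) × EuclideanSpace ℝ (Fin n) =>
              (y.1.1, y.1.2, y.2)) (by fun_prop))
      _ ≤ C * ∫⁻ t in Ioo (0 : ℝ) 1, ENNReal.ofReal (t ^ (-(1 / 2) : ℝ)) *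
          (180 * ∫⁻ w, ρ w ^ n) := by
          refine mul_le_mul_right (setLIntegral_mono' measurableSet_Ioo fun t ht => ?_) _
          rw [lintegral_lintegral_swap]
          swap
          · exact (hmF.comp (f := fun y : ℝ × EuclideanSpace ℝ (Fin n) =>
              (y.1, t, y.2)) (by fun_prop)).aemeasurable
          calc _ ≤ ∫⁻ w, ENNReal.ofReal (t ^ (-(3 / 2) : ℝ)) * ENNReal.ofReal (180 * t) *
                ρ w ^ n := by
                refine lintegral_mono fun w => ?_
                calc _ = ∫⁻ r in Ioo δ d, (ENNReal.ofReal r⁻¹ *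
                      (sphereShell x₀ r t).indicator 1 w) *
                      (ENNReal.ofReal (t ^ (-(3 / 2) : ℝ)) * ρ w ^ n) := by
                      refine lintegral_congr fun r => ?_
                      ring
                  _ = (∫⁻ r in Ioo δ d, ENNReal.ofReal r⁻¹ *
                      (sphereShell x₀ r t).indicator 1 w) *
                      (ENNReal.ofReal (t ^ (-(3 / 2) : ℝ)) * ρ w ^ n) :=
                      lintegral_mul_const _ ((by fun_prop : Measurable fun r : ℝ =>
                        ENNReal.ofReal r⁻¹).mul (hmW.comp (f := fun r : ℝ => (r, t, w))
                          (by fun_prop)))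
                  _ ≤ ENNReal.ofReal (180 * t) *
                      (ENNReal.ofReal (t ^ (-(3 / 2) : ℝ)) * ρ w ^ n) := by
                      gcongr
                      exact lintegral_inv_sphereShell_le x₀ w ht.1.le hδ
                  _ = _ := by ring
            _ = _ := by
                rw [lintegral_const_mul _ (by fun_prop), ← mul_assoc]
                congr 1
                rw [ENNReal.ofReal_mul (by norm_num), ENNReal.ofReal_ofNat, mul_left_comm,
                  ← ENNReal.ofReal_mul (Real.rpow_nonneg ht.1.le _), mul_comm]
                congr 2
                nth_rewrite 2 [← Real.rpow_one t]
                rw [← Real.rpow_add ht.1]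
                norm_num
      _ = _ := by
          rw [lintegral_mul_const _ (by fun_prop), ← hI]
          ring
  calc _ = ω⁻¹ * (ω * ENNReal.ofReal (Real.log (d / δ))) := by
        rw [← mul_assoc, ENNReal.inv_mul_cancel hω0 hωt, one_mul]
    _ ≤ ω⁻¹ * (C * (180 * I * ∫⁻ x, ρ x ^ n)) := by gcongr
    _ = _ := by ring

/-- A connected set meeting the image of a ball and not covered by the image of the closed ball
meets the image of the sphere. -/
lemma exists_dist_eq_of_isPreconnected {n : ℕ} {D : Set (EuclideanSpace ℝ (Fin n))}
    {f : EuclideanSpace ℝ (Fin n) → EuclideanSpace ℝ (Fin n)} (hf : ContinuousOn f D)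
    (hfo : IsOpenOn n D f) {x₀ x : EuclideanSpace ℝ (Fin n)} {r : ℝ}
    (hr : closedBall x₀ r ⊆ D) {E : Set (EuclideanSpace ℝ (Fin n))} (hE : IsPreconnected E)
    (hx : dist x x₀ < r) (hxE : f x ∈ E) (hEn : ¬ E ⊆ f '' closedBall x₀ r) :
    ∃ p, dist p x₀ = r ∧ f p ∈ E := by
  by_contra! h
  have hU : IsOpen (f '' ball x₀ r) := hfo _ isOpen_ball (ball_subset_closedBall.trans hr)
  have hV : IsOpen (f '' closedBall x₀ r)ᶜ :=
    ((isCompact_closedBall x₀ r).image_of_continuousOn (hf.mono hr)).isClosed.isOpen_compl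
  obtain ⟨y, hyE, hy⟩ := not_subset.1 hEn
  obtain ⟨z, -, hz1, hz2⟩ := hE _ _ hU hV (fun w hw => by
      by_cases hw2 : w ∈ f '' closedBall x₀ r
      · obtain ⟨p, hp, rfl⟩ := hw2
        exact Or.inl ⟨p, lt_of_le_of_ne hp fun hpr => h p hpr hw, rfl⟩
      · exact Or.inr hw2) ⟨f x, hxE, x, hx, rfl⟩ ⟨y, hyE, hy⟩
  exact hz2 (image_mono ball_subset_closedBall hz1)

section
variable {V : Type*} [NormedAddCommGroup V] [InnerProductSpace ℝ V]

/-- The closed ray from `v` in direction `e`. -/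
def closedRay (v e : V) : Set V := (fun s : ℝ => v + s • e) '' Ici 0

lemma isPreconnected_closedRay (v e : V) : IsPreconnected (closedRay v e) :=
  isPreconnected_Ici.image _ (by fun_prop)

lemma left_mem_closedRay (v e : V) : v ∈ closedRay v e := ⟨0, self_mem_Ici, by simp⟩

lemma not_isBounded_closedRay (v : V) {e : V} (he : e ≠ 0) :
    ¬ Bornology.IsBounded (closedRay v e) := by
  intro h
  obtain ⟨C, hC⟩ := h.exists_norm_le
  have hpos : 0 < ‖e‖ := norm_pos_iff.2 he
  have hC0 : 0 ≤ C := (norm_nonneg v).trans (hC v (left_mem_closedRay v e))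
  have h1 := hC _ ⟨(C + ‖v‖ + 1) / ‖e‖, mem_Ici.2 (by positivity), rfl⟩
  have h2 := norm_sub_le (v + ((C + ‖v‖ + 1) / ‖e‖) • e) v
  rw [add_sub_cancel_left, norm_smul, Real.norm_of_nonneg (by positivity),
    div_mul_cancel₀ _ hpos.ne'] at h2
  linarith

lemma le_dist_of_mem_closedRay {v e w z : V} {c : ℝ} (he : e ≠ 0)
    (h : c * ‖e‖ ≤ inner ℝ (v - w) e) (hz : z ∈ closedRay v e) : c ≤ dist w z := by
  obtain ⟨s, hs, rfl⟩ := hz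
  have hpos : 0 < ‖e‖ := norm_pos_iff.2 he
  have h1 := real_inner_le_norm (v + s • e - w) e
  have e1 : v + s • e - w = (v - w) + s • e := by module
  rw [e1, inner_add_left, real_inner_smul_left, real_inner_self_eq_norm_sq, ← e1] at h1
  rw [dist_comm, dist_eq_norm]
  have : 0 ≤ s * ‖e‖ ^ 2 := mul_nonneg hs (by positivity)
  exact le_of_mul_le_mul_right (by linarith) hpos

/-- Two points at distance at least `ε` can be joined to `a` and to infinity, in one of the two
ways, by connected sets at distance at least `ε / 4`. -/
lemma exists_separated_connected {ε R : ℝ} (hε : 0 < ε) {a y z : V} (ha : ‖a‖ ≤ R)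
    (hy : ‖y‖ ≤ R) (hyz : ε ≤ dist y z) :
    ∃ E₁ E₂ : Set V, IsPreconnected E₁ ∧ IsPreconnected E₂ ∧ a ∈ E₁ ∧
      E₁ ⊆ closedBall 0 (R + ε) ∧ ¬ Bornology.IsBounded E₂ ∧
      (y ∈ E₁ ∧ z ∈ E₂ ∨ z ∈ E₁ ∧ y ∈ E₂) ∧ ∀ u ∈ E₁, ∀ v ∈ E₂, ε / 4 ≤ dist u v := by
  have hball : ∀ {r : ℝ} {w : V}, ‖w‖ ≤ r ↔ w ∈ closedBall 0 r := by simp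
  have hseg : segment ℝ y a ⊆ closedBall 0 R :=
    (convex_closedBall _ _).segment_subset (hball.1 hy) (hball.1 ha)
  have hcomp : IsCompact (segment ℝ y a) := by
    rw [segment_eq_image_lineMap]
    exact isCompact_Icc.image (AffineMap.lineMap_continuous)
  obtain ⟨m, hm, hmd⟩ := hcomp.exists_infDist_eq_dist ⟨y, left_mem_segment ℝ y a⟩ z
  rcases le_or_gt (ε / 4) (dist z m) with hzm | hzm
  · have hne : z - m ≠ 0 := by
      rw [sub_ne_zero, ← dist_pos]; linarith
    have hmin : ‖z - m‖ = ⨅ w : segment ℝ y a, ‖z - w‖ := by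
      rw [← dist_eq_norm, ← hmd, infDist_eq_iInf]
      simp_rw [dist_eq_norm]
    have hproj := (norm_eq_iInf_iff_real_inner_le_zero (convex_segment y a) hm).1 hmin
    refine ⟨segment ℝ y a, closedRay z (z - m), (convex_segment y a).isPreconnected,
      isPreconnected_closedRay _ _, right_mem_segment ℝ y a,
      hseg.trans (closedBall_subset_closedBall (by linarith)), not_isBounded_closedRay _ hne,
      Or.inl ⟨left_mem_segment ℝ y a, left_mem_closedRay _ _⟩, fun u hu v hv => ?_⟩
    refine le_dist_of_mem_closedRay hne ?_ hv
    have h1 := hproj u hu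
    have e1 : z - u = (z - m) - (u - m) := by abel
    rw [e1, inner_sub_left, real_inner_self_eq_norm_sq, real_inner_comm]
    rw [dist_eq_norm] at hzm
    nlinarith [norm_nonneg (z - m)]
  · obtain ⟨θ, hθ, rfl⟩ : ∃ θ ∈ Icc (0 : ℝ) 1, y + θ • (a - y) = m := by
      rwa [segment_eq_image'] at hm
    set e := y - a with he
    have hye : ε - ε / 4 ≤ θ * ‖e‖ := by
      have h1 := dist_triangle_right y z (y + θ • (a - y))
      have h2 : dist y (y + θ • (a - y)) = θ * ‖e‖ := by
        rw [dist_comm, dist_eq_norm, add_sub_cancel_left, norm_smul, Real.norm_of_nonneg hθ.1,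
          he, norm_sub_rev]
      linarith
    have hepos : 0 < ‖e‖ := by
      by_contra! h0
      nlinarith [norm_nonneg e, hθ.1]
    have hee : ε - ε / 4 ≤ ‖e‖ := by nlinarith [hθ.2]
    have hne : e ≠ 0 := norm_pos_iff.1 hepos
    have hz : ‖z‖ ≤ R + ε := by
      have h1 := hball.2 (hseg hm)
      have h2 := norm_sub_norm_le z (y + θ • (a - y))
      rw [← dist_eq_norm] at h2
      linarith
    refine ⟨segment ℝ z a, closedRay y e, (convex_segment z a).isPreconnected,
      isPreconnected_closedRay _ _, right_mem_segment ℝ z a,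
      (convex_closedBall _ _).segment_subset (hball.1 hz) (hball.1 (by linarith)),
      not_isBounded_closedRay _ hne,
      Or.inr ⟨left_mem_segment ℝ z a, left_mem_closedRay _ _⟩, fun u hu v hv => ?_⟩
    refine le_dist_of_mem_closedRay hne ?_ hv
    obtain ⟨α, β, hα, hβ, hαβ, rfl⟩ := hu
    have hz1 : (θ * ‖e‖ - ε / 4) * ‖e‖ ≤ inner ℝ (y - z) e := by
      have e1 : y - z = θ • e - (z - (y + θ • (a - y))) := by rw [he]; module
      have h1 := real_inner_le_norm (z - (y + θ • (a - y))) e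
      rw [dist_eq_norm] at hzm
      rw [e1, inner_sub_left, real_inner_smul_left, real_inner_self_eq_norm_sq]
      nlinarith
    have e2 : y - (α • z + β • a) = α • (y - z) + β • e := by
      rw [he, show α = 1 - β by linarith]; module
    rw [e2, inner_add_left, real_inner_smul_left, real_inner_smul_left, real_inner_self_eq_norm_sq]
    have h3 : ε / 4 * ‖e‖ ≤ inner ℝ (y - z) e := by nlinarith
    have h4 : ε / 4 * ‖e‖ ≤ ‖e‖ ^ 2 := by nlinarith
    calc ε / 4 * ‖e‖ = α * (ε / 4 * ‖e‖) + β * (ε / 4 * ‖e‖) := by rw [← add_mul, hαβ, one_mul]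
      _ ≤ _ := by gcongr

end

lemma chordal_le_dist {n : ℕ} (x y : EuclideanSpace ℝ (Fin n)) : chordal n x y ≤ dist x y := by
  have h : ∀ z : EuclideanSpace ℝ (Fin n), 1 ≤ Real.sqrt (1 + ‖z‖ ^ 2) := fun z => by
    rw [Real.one_le_sqrt]; nlinarith [sq_nonneg ‖z‖]
  exact div_le_self dist_nonneg (one_le_mul_of_one_le_of_one_le (h x) (h y))

lemma norm_le_or_norm_le_of_le_chordal {n : ℕ} {ε : ℝ} (hε : 0 < ε)
    {x y : EuclideanSpace ℝ (Fin n)} (h : ε ≤ chordal n x y) : ‖x‖ ≤ 2 / ε ∨ ‖y‖ ≤ 2 / ε := by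
  by_contra! hc
  have hpos : 0 < 2 / ε := by positivity
  have hx := hpos.trans hc.1
  have hy := hpos.trans hc.2
  have hs : ∀ z : EuclideanSpace ℝ (Fin n), ‖z‖ ≤ Real.sqrt (1 + ‖z‖ ^ 2) := fun z =>
    Real.le_sqrt_of_sq_le (by linarith)
  have h1 : chordal n x y ≤ (‖x‖ + ‖y‖) / (‖x‖ * ‖y‖) := by
    rw [chordal]
    gcongr
    · rw [dist_eq_norm]; exact norm_sub_le _ _
    · exact hs x
    · exact hs y
  have h2 := h.trans h1
  rw [le_div_iff₀ (by positivity)] at h2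
  rw [div_lt_iff₀ hε, div_lt_iff₀ hε] at hc
  nlinarith

lemma twoSegmentPath_zero {n : ℕ} (p z q : EuclideanSpace ℝ (Fin n)) :
    twoSegmentPath p z q 0 = p := by
  simp [twoSegmentPath]

lemma twoSegmentPath_two {n : ℕ} (p z q : EuclideanSpace ℝ (Fin n)) :
    twoSegmentPath p z q 2 = q := by
  norm_num [twoSegmentPath]

/-- **Corollary 3 (Montel-type theorem, two omitted points, locally integrable `Q`).** -/
theorem equicontinuity_of_family_omitting_two_points_of_locInt
    (n : ℕ) (hn : 2 ≤ n)
    (D : Set (EuclideanSpace ℝ (Fin n))) (hD : IsOpen D) (hDconn : IsConnected D)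
    (a b : EuclideanSpace ℝ (Fin n)) (hab : a ≠ b)
    (Q : EuclideanSpace ℝ (Fin n) → ℝ≥0∞) (hQmeas : Measurable Q)
    (hQloc : ∀ K : Set (EuclideanSpace ℝ (Fin n)), IsCompact K → (∫⁻ y in K, Q y) < ∞)
    (x₀ : EuclideanSpace ℝ (Fin n)) (hx₀ : x₀ ∈ D) :
    EquicontinuousAtPt n D
      {f | ContinuousOn f D ∧ IsOpenOn n D f ∧ IsDiscreteOn n D f ∧
        (∀ x ∈ D, f x ≠ a ∧ f x ≠ b) ∧ ∀ y₀, InvPoletsky n D f Q y₀} x₀ := by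
  intro ε hε
  set R := max ‖a‖ (2 / ε) with hR
  obtain ⟨C, hC, hdens⟩ := exists_uniform_density (n := n) (by omega) hQmeas hQloc
    (isCompact_closedBall 0 (R + ε + (ε / 8 + 1))) (δ := ε / 8) (by positivity)
  obtain ⟨C', hC', hlog⟩ := exists_log_le_lintegral_pow hn
  obtain ⟨d', hd', hball'⟩ := Metric.nhds_basis_closedBall.mem_iff.1 (hD.mem_nhds hx₀)
  set d := d' / 5 with hd
  have hdpos : 0 < d := by positivity
  have hball : ∀ r ≤ d, closedBall x₀ (5 * r) ⊆ D := fun r hr =>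
    (closedBall_subset_closedBall (by linarith)).trans hball'
  set T := (C' * C).toReal + 1 with hT
  have hTpos : 0 < T := by positivity
  refine ⟨d * Real.exp (-T), by positivity, ?_⟩
  set δ := d * Real.exp (-T) with hδ
  have hδpos : 0 < δ := by positivity
  have hδd : δ < d := mul_lt_of_lt_one_right hdpos (Real.exp_lt_one_iff.2 (by linarith))
  rintro f ⟨hf, hfo, -, hab', hP⟩ x hx hxd
  by_contra! hch
  obtain ⟨ρ, hρ, hρI, hadm⟩ := hdens D f hD hf hP
  obtain ⟨E₁, E₂, hE₁, hE₂, haE, hE₁b, hE₂b, ⟨x₁, x₂, hx₁, hx₂, hx₁E, hx₂E⟩, hsep⟩ :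
      ∃ E₁ E₂ : Set (EuclideanSpace ℝ (Fin n)), IsPreconnected E₁ ∧ IsPreconnected E₂ ∧ a ∈ E₁ ∧
      E₁ ⊆ closedBall 0 (R + ε) ∧ ¬ Bornology.IsBounded E₂ ∧
      (∃ x₁ x₂, dist x₁ x₀ < δ ∧ dist x₂ x₀ < δ ∧ f x₁ ∈ E₁ ∧ f x₂ ∈ E₂) ∧
      ∀ u ∈ E₁, ∀ v ∈ E₂, ε / 4 ≤ dist u v := by
    have hx₀d : dist x₀ x₀ < δ := by rwa [dist_self]
    have hdist := hch.trans (chordal_le_dist _ _)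
    rcases norm_le_or_norm_le_of_le_chordal hε hch with h | h
    · obtain ⟨E₁, E₂, h1, h2, h3, h4, h5, h6, h7⟩ := exists_separated_connected hε
        (le_max_left ‖a‖ (2 / ε)) (h.trans (le_max_right _ _)) hdist
      refine ⟨E₁, E₂, h1, h2, h3, h4, h5, ?_, h7⟩
      rcases h6 with h6 | h6
      · exact ⟨x, x₀, hxd, hx₀d, h6⟩
      · exact ⟨x₀, x, hx₀d, hxd, h6⟩
    · rw [dist_comm] at hdist
      obtain ⟨E₁, E₂, h1, h2, h3, h4, h5, h6, h7⟩ := exists_separated_connected hε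
        (le_max_left ‖a‖ (2 / ε)) (h.trans (le_max_right _ _)) hdist
      refine ⟨E₁, E₂, h1, h2, h3, h4, h5, ?_, h7⟩
      rcases h6 with h6 | h6
      · exact ⟨x₀, x, hx₀d, hxd, h6⟩
      · exact ⟨x, x₀, hxd, hx₀d, h6⟩
  have hlow := hlog ρ hρ x₀ δ d hδpos hδd fun r hr => by
    have hrpos : 0 < r := hδpos.trans hr.1
    have hrD : closedBall x₀ r ⊆ D :=
      (closedBall_subset_closedBall (by linarith)).trans (hball r hr.2.le)
    obtain ⟨p, hp, hpE⟩ := exists_dist_eq_of_isPreconnected hf hfo hrD hE₁ (hx₁.trans hr.1) hx₁E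
      (fun h => by
        obtain ⟨w, hw, hwa⟩ := h haE
        exact (hab' w (hrD hw)).1 hwa)
    obtain ⟨q, hq, hqE⟩ := exists_dist_eq_of_isPreconnected hf hfo hrD hE₂ (hx₂.trans hr.1) hx₂E
      (fun h => hE₂b (((isCompact_closedBall x₀ r).image_of_continuousOn
        (hf.mono hrD)).isBounded.subset h))
    refine ⟨p, q, hp, hq, fun z hz => ?_⟩
    have hKp : dist p z ≤ (⟨6 * r, by positivity⟩ : ℝ≥0) := by
      change dist p z ≤ 6 * r
      linarith [dist_triangle_right p z x₀]
    have hKq : dist q z ≤ (⟨6 * r, by positivity⟩ : ℝ≥0) := by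
      change dist q z ≤ 6 * r
      linarith [dist_triangle_right q z x₀]
    refine hadm ⟨0, 2, by norm_num, twoSegmentPath p z q,
      (lipschitzWith_twoSegmentPath hKp hKq).continuous.continuousOn⟩ (fun t ht => ?_)
      (fun y => infDist y E₁) (lipschitz_infDist_pt E₁) ?_ ?_ ?_
    · exact hball r hr.2.le (twoSegmentPath_mem (convex_closedBall _ _)
        (mem_closedBall.2 (by linarith)) (mem_closedBall.2 hz) (mem_closedBall.2 (by linarith)) ht)
    · rintro y ⟨-, hy⟩
      have hy' : infDist y E₁ < ε / 8 + 1 := lt_of_le_of_lt hy (by linarith)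
      obtain ⟨w, hw, hyw⟩ := (infDist_lt_iff ⟨a, haE⟩).1 hy'
      have := mem_closedBall.1 (hE₁b hw)
      exact mem_closedBall.2 (by linarith [dist_triangle y w 0])
    · simp only [twoSegmentPath_zero]
      exact (infDist_zero_of_mem hpE).le
    · simp only [twoSegmentPath_two]
      refine (le_infDist ⟨a, haE⟩).2 fun {w} hw => ?_
      rw [dist_comm]
      linarith [hsep w hw _ hqE]
  have hup := hlow.trans (mul_le_mul_right hρI C')
  have hlogT : Real.log (d / δ) = T := by
    rw [hδ, div_mul_cancel_left₀ hdpos.ne', ← Real.exp_neg, neg_neg, Real.log_exp]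
  rw [hlogT, ENNReal.ofReal_le_iff_le_toReal (by finiteness)] at hup
  linarith

end
end

section
/- Let D ⊂ ℝⁿ (n ≥ 2) be a domain, Q : ℝⁿ → [0,∞] Lebesgue measurable, and let f : D → ℝⁿ satisfy the inverse Poletsky inequality at y₀ ∈ ℝⁿ with majorant Q, with associated radius r₀ = r₀(y₀) > 0. Let 0 < r₁ < r₂ < r₀, set Q̃ = max(Q, 1), q̃(r) = (1/(ω_{n−1} r^{n−1})) ∫_{S(y₀,r)} Q̃ dH^{n−1}, and I = ∫_{r₁}^{r₂} dr/(r · q̃(r)^{1/(n−1)}). Suppose there is a set E ⊂ [r₁, r₂] of positive linear Lebesgue measure such that Q is H^{n−1}-integrable over S(y₀, r) for every r ∈ E. Then 0 < I < ∞ and M(Γ_f(y₀, r₁, r₂)) ≤ ω_{n−1}/I^{n−1}. -/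
open MeasureTheory Metric Set Filter Topology
open scoped ENNReal NNReal

noncomputable section
open scoped Classical

/-- `ω_{n−1}`: the `(n−1)`-dimensional Hausdorff measure (area) of the unit sphere in `ℝⁿ`. -/
def sphereArea (n : ℕ) : ℝ≥0∞ :=
  μH[(n : ℝ) - 1] (Metric.sphere (0 : EuclideanSpace ℝ (Fin n)) 1)

/-- `q̃(r) = (1/(ω_{n−1} r^{n−1})) ∫_{S(y₀,r)} Q dH^{n−1}`. -/
def sphereAvg (n : ℕ) (Q : EuclideanSpace ℝ (Fin n) → ℝ≥0∞)
    (y₀ : EuclideanSpace ℝ (Fin n)) (r : ℝ) : ℝ≥0∞ :=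
  (∫⁻ y in Metric.sphere y₀ r, Q y ∂(μH[(n : ℝ) - 1])) /
    (sphereArea n * ENNReal.ofReal (r ^ (n - 1)))

/-- `I = ∫_{r₁}^{r₂} dr/(r · q̃(r)^{1/(n−1)})`. -/
def Ifun (n : ℕ) (Q : EuclideanSpace ℝ (Fin n) → ℝ≥0∞)
    (y₀ : EuclideanSpace ℝ (Fin n)) (r₁ r₂ : ℝ) : ℝ≥0∞ :=
  ∫⁻ r in Set.Ioo r₁ r₂,
    (ENNReal.ofReal r * sphereAvg n Q y₀ r ^ (1 / ((n : ℝ) - 1)))⁻¹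

/-- The surface measure on the unit sphere that occurs in polar coordinates, as a measure on the
ambient space. -/
def polarMeasure (n : ℕ) : Measure (EuclideanSpace ℝ (Fin n)) :=
  (volume : Measure (EuclideanSpace ℝ (Fin n))).toSphere.map Subtype.val

instance (n : ℕ) : IsFiniteMeasure (polarMeasure n) := by
  unfold polarMeasure; infer_instance

theorem polarMeasure_univ_ne_zero (k : ℕ) : polarMeasure (k + 1) univ ≠ 0 := by
  rw [polarMeasure, Measure.map_apply measurable_subtype_coe .univ, preimage_univ,
    Measure.measure_univ_ne_zero]
  exact Measure.toSphere_ne_zero _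

theorem polarMeasure_compl_sphere (n : ℕ) : polarMeasure n (sphere 0 1)ᶜ = 0 := by
  rw [polarMeasure, Measure.map_apply measurable_subtype_coe isClosed_sphere.measurableSet.compl]
  have : (Subtype.val ⁻¹' (sphere 0 1)ᶜ : Set (sphere (0 : EuclideanSpace ℝ (Fin n)) 1)) = ∅ := by
    ext x
    simp
  rw [this, measure_empty]

/-- Integration in polar coordinates. -/
theorem lintegral_polar {k : ℕ} {F : EuclideanSpace ℝ (Fin (k + 1)) → ℝ≥0∞} (hF : Measurable F) :
    ∫⁻ x, F x = ∫⁻ r in Ioi (0 : ℝ), ENNReal.ofReal (r ^ k) *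
      ∫⁻ θ, F (r • θ) ∂polarMeasure (k + 1) := by
  have hmap (r : ℝ) : ∫⁻ θ, F (r • θ) ∂polarMeasure (k + 1) =
      ∫⁻ θ : sphere (0 : EuclideanSpace ℝ (Fin (k + 1))) 1, F (r • θ.1) ∂volume.toSphere := by
    rw [polarMeasure, lintegral_map (by fun_prop) measurable_subtype_coe]
  have hpol := (volume : Measure (EuclideanSpace ℝ (Fin (k + 1)))).measurePreserving_homeomorphUnitSphereProd
  have hsymm := hpol.symm (homeomorphUnitSphereProd _).toMeasurableEquiv
  have hmeas : Measurable fun p : sphere (0 : EuclideanSpace ℝ (Fin (k + 1))) 1 × Ioi (0 : ℝ) =>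
      F (p.2.1 • p.1.1) := by fun_prop
  calc ∫⁻ x, F x = ∫⁻ x in {0}ᶜ, F x := by rw [restrict_compl_singleton]
    _ = ∫⁻ x : ({0}ᶜ : Set (EuclideanSpace ℝ (Fin (k + 1)))),
          F x ∂(volume.comap Subtype.val) :=
      (lintegral_subtype_comap (measurableSet_singleton _).compl _).symm
    _ = ∫⁻ p : sphere (0 : EuclideanSpace ℝ (Fin (k + 1))) 1 × Ioi (0 : ℝ),
          F (p.2.1 • p.1.1) ∂(volume.toSphere.prod (Measure.volumeIoiPow k)) := by
      have := hsymm.lintegral_comp_emb (MeasurableEquiv.measurableEmbedding _)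
        (fun x : ({0}ᶜ : Set (EuclideanSpace ℝ (Fin (k + 1)))) => F x)
      rw [← this]
      simp
    _ = ∫⁻ r : Ioi (0 : ℝ), ∫⁻ θ : sphere (0 : EuclideanSpace ℝ (Fin (k + 1))) 1,
          F (r.1 • θ.1) ∂volume.toSphere ∂(Measure.volumeIoiPow k) :=
      lintegral_prod_symm _ hmeas.aemeasurable
    _ = ∫⁻ r : Ioi (0 : ℝ), ENNReal.ofReal (r.1 ^ k) *
          ∫⁻ θ, F (r.1 • θ) ∂polarMeasure (k + 1) ∂(Measure.comap Subtype.val volume) := by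
      rw [Measure.volumeIoiPow, lintegral_withDensity_eq_lintegral_mul _ (by fun_prop)
        (Measurable.lintegral_prod_left' hmeas)]
      simp [hmap]
    _ = _ := lintegral_subtype_comap measurableSet_Ioi
      (fun r : ℝ => ENNReal.ofReal (r ^ k) * ∫⁻ θ, F (r • θ) ∂polarMeasure (k + 1))

/-- An orthonormal basis starting with a given unit vector. -/
theorem exists_orthonormalBasis_zero_eq {k : ℕ} {v : EuclideanSpace ℝ (Fin (k + 1))}
    (hv : ‖v‖ = 1) :
    ∃ b : OrthonormalBasis (Fin (k + 1)) ℝ (EuclideanSpace ℝ (Fin (k + 1))), b 0 = v := by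
  have h : Orthonormal ℝ (({0} : Set (Fin (k + 1))).domRestrict fun _ => v) := by
    refine ⟨fun _ => hv, fun i j hij => ?_⟩
    exact absurd (Subsingleton.elim i j) hij
  obtain ⟨b, hb⟩ := h.exists_orthonormalBasis_extension_of_card_eq (by simp)
  exact ⟨b, hb 0 rfl⟩

/-- The coordinates of a vector with respect to all but the first vector of a basis. -/
def tailCoord {k : ℕ} (b : OrthonormalBasis (Fin (k + 1)) ℝ (EuclideanSpace ℝ (Fin (k + 1))))
    (x : EuclideanSpace ℝ (Fin (k + 1))) : Fin k → ℝ :=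
  fun i => b.repr x i.succ

theorem volume_coord_preimage_prod {k : ℕ}
    (b : OrthonormalBasis (Fin (k + 1)) ℝ (EuclideanSpace ℝ (Fin (k + 1))))
    (I : Set ℝ) (B : Set (Fin k → ℝ)) :
    volume {x | b.repr x 0 ∈ I ∧ tailCoord b x ∈ B} = volume I * volume B := by
  have h := ((volume_preserving_piFinSuccAbove (fun _ : Fin (k + 1) => ℝ) 0).comp
    ((EuclideanSpace.volume_preserving_symm_measurableEquiv_toLp (Fin (k + 1))))).comp
    b.measurePreserving_repr
  let e := (b.repr.toHomeomorph.toMeasurableEquiv.trans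
    (MeasurableEquiv.toLp 2 (Fin (k + 1) → ℝ)).symm).trans
    (MeasurableEquiv.piFinSuccAbove (fun _ : Fin (k + 1) => ℝ) 0)
  have he : MeasurePreserving e volume volume := h
  rw [← Measure.prod_prod, ← Measure.volume_eq_prod, ← he.measure_preimage_equiv]
  rfl

theorem hausdorffMeasure_fin (k : ℕ) : (μH[(k : ℝ)] : Measure (Fin k → ℝ)) = volume := by
  simpa using hausdorffMeasure_pi_real (ι := Fin k)

theorem volume_tailCoord_image_le {k : ℕ}
    (b : OrthonormalBasis (Fin (k + 1)) ℝ (EuclideanSpace ℝ (Fin (k + 1))))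
    (A : Set (EuclideanSpace ℝ (Fin (k + 1)))) :
    volume (tailCoord b '' A) ≤ μH[(k : ℝ)] A := by
  have hlip : LipschitzWith 1 (tailCoord b) := by
    refine LipschitzWith.of_dist_le_mul fun x y => ?_
    rw [NNReal.coe_one, one_mul, dist_pi_le_iff dist_nonneg]
    intro i
    rw [← b.repr.dist_map x y, dist_eq_norm, dist_eq_norm]
    exact PiLp.norm_apply_le (b.repr x - b.repr y) i.succ
  rw [← hausdorffMeasure_fin]
  simpa using hlip.hausdorffMeasure_image_le k.cast_nonneg A

/-- Replaces the tangential part of `x` at `v` by that of `x / ‖x‖`, and the normal part by `‖x‖`;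
this map sends the cone over a subset of the sphere into a cylinder. -/
def coneToCylinder {k : ℕ} (v x : EuclideanSpace ℝ (Fin (k + 1))) : EuclideanSpace ℝ (Fin (k + 1)) :=
  ‖x‖⁻¹ • (x - inner ℝ v x • v) + ‖x‖ • v

theorem hasStrictFDerivAt_coneToCylinder {k : ℕ} {v : EuclideanSpace ℝ (Fin (k + 1))}
    (hv : ‖v‖ = 1) :
    HasStrictFDerivAt (coneToCylinder v) (ContinuousLinearMap.id ℝ _) v := by
  have hnorm : HasStrictFDerivAt (fun x : EuclideanSpace ℝ (Fin (k + 1)) => ‖x‖)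
      (innerSL ℝ v) v := by
    have h := (hasStrictFDerivAt_norm_sq v).sqrt (by simp [hv])
    simp only [Real.sqrt_sq (norm_nonneg _), hv] at h
    exact h.congr_fderiv (by ext x; simp)
  have hinv := (hasStrictDerivAt_inv (x := ‖v‖) (by simp [hv])).comp_hasStrictFDerivAt v hnorm
  have hproj : HasStrictFDerivAt (fun x => x - inner ℝ v x • v)
      (ContinuousLinearMap.id ℝ _ - (innerSL ℝ v).smulRight v) v :=
    (hasStrictFDerivAt_id v).sub ((innerSL ℝ v).hasStrictFDerivAt.smul_const v)
  refine ((hinv.smul hproj).add (hnorm.smul_const v)).congr_fderiv ?_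
  ext x i
  simp [hv]

/-- The part of the cone over `A` between the radii `1` and `1 + δ`. -/
def coneShell {k : ℕ} (A : Set (EuclideanSpace ℝ (Fin (k + 1)))) (δ : ℝ) :
    Set (EuclideanSpace ℝ (Fin (k + 1))) :=
  {x | ‖x‖ ∈ Ioo 1 (1 + δ) ∧ ‖x‖⁻¹ • x ∈ A}

theorem mul_polarMeasure_le_volume_coneShell {k : ℕ} {A : Set (EuclideanSpace ℝ (Fin (k + 1)))}
    (hA : MeasurableSet A) (hAS : A ⊆ sphere 0 1) (δ : ℝ) :
    ENNReal.ofReal δ * polarMeasure (k + 1) A ≤ volume (coneShell A δ) := by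
  have hmeas : MeasurableSet (coneShell A δ) :=
    (measurable_norm measurableSet_Ioo).inter
      ((measurable_norm.inv.smul measurable_id : Measurable
        fun x : EuclideanSpace ℝ (Fin (k + 1)) => ‖x‖⁻¹ • x) hA)
  rw [← lintegral_indicator_one hmeas, lintegral_polar (measurable_one.indicator hmeas)]
  calc ENNReal.ofReal δ * polarMeasure (k + 1) A
      = ∫⁻ _ in Ioo (1 : ℝ) (1 + δ), polarMeasure (k + 1) A := by
        rw [setLIntegral_const, Real.volume_Ioo, add_sub_cancel_left, mul_comm]
    _ ≤ ∫⁻ r in Ioo (1 : ℝ) (1 + δ), ENNReal.ofReal (r ^ k) *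
          ∫⁻ θ, (coneShell A δ).indicator 1 (r • θ) ∂polarMeasure (k + 1) := by
        refine setLIntegral_mono' measurableSet_Ioo fun r hr => ?_
        have hr0 : (0 : ℝ) < r := one_pos.trans hr.1
        have hone : 1 ≤ ENNReal.ofReal (r ^ k) := by
          rw [ENNReal.one_le_ofReal]
          exact one_le_pow₀ hr.1.le
        refine le_trans ?_ (mul_le_mul' hone le_rfl)
        rw [one_mul, ← lintegral_indicator_one hA]
        refine lintegral_mono fun θ => ?_
        by_cases hθ : θ ∈ A
        swap
        · simp [hθ]
        have hn : ‖θ‖ = 1 := by simpa using hAS hθ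
        have hmem : r • θ ∈ coneShell A δ := by
          have hnr : ‖r • θ‖ = r := by rw [norm_smul, hn, mul_one, Real.norm_of_nonneg hr0.le]
          refine ⟨by rwa [hnr], ?_⟩
          rwa [hnr, inv_smul_smul₀ hr0.ne']
        rw [indicator_of_mem hmem, indicator_of_mem hθ]
        simp
    _ ≤ _ := lintegral_mono_set fun r hr => one_pos.trans hr.1

theorem exists_nhds_mul_polarMeasure_le {k : ℕ} {v : EuclideanSpace ℝ (Fin (k + 1))}
    (hv : ‖v‖ = 1) {m : ℝ≥0} (hm : m < 1) :
    ∃ ε > 0, ∀ A ⊆ ball v ε ∩ sphere 0 1, MeasurableSet A →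
      m * polarMeasure (k + 1) A ≤ μH[(k : ℝ)] A := by
  obtain ⟨b, hb⟩ := exists_orthonormalBasis_zero_eq hv
  have hdet : (m : ℝ≥0∞) < ENNReal.ofReal
      |(ContinuousLinearMap.id ℝ (EuclideanSpace ℝ (Fin (k + 1)))).det| := by
    simpa [ContinuousLinearMap.det] using hm
  obtain ⟨c, hc, hcpos⟩ := ((mul_le_addHaar_image_of_lt_det volume _ hdet).and
    self_mem_nhdsWithin).exists
  obtain ⟨U, hU, happrox⟩ := (hasStrictFDerivAt_coneToCylinder hv).approximates_deriv_on_nhds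
    (Or.inr hcpos)
  obtain ⟨ε, hε, hεU⟩ := Metric.mem_nhds_iff.1 hU
  refine ⟨ε / 2, half_pos hε, fun A hA hAm => ?_⟩
  have hδ0 : ENNReal.ofReal (ε / 2) ≠ 0 := by simpa using hε
  have hsub : coneShell A (ε / 2) ⊆ U := by
    rintro x ⟨hx, hxA⟩
    refine hεU ?_
    have h1 := (hA hxA).1
    rw [mem_ball] at h1 ⊢
    have h2 : dist x (‖x‖⁻¹ • x) < ε / 2 := by
      have hx0 : ‖x‖ ≠ 0 := (one_pos.trans hx.1).ne'
      have : x - ‖x‖⁻¹ • x = (1 - ‖x‖⁻¹) • x := by rw [sub_smul, one_smul]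
      have h3 : ‖x‖⁻¹ ≤ 1 := inv_le_one_of_one_le₀ hx.1.le
      rw [dist_eq_norm, this, norm_smul, Real.norm_of_nonneg (by linarith), sub_mul, one_mul,
        inv_mul_cancel₀ hx0]
      linarith [hx.2]
    linarith [dist_triangle x (‖x‖⁻¹ • x) v]
  have himage : coneToCylinder v '' coneShell A (ε / 2) ⊆
      {x | b.repr x 0 ∈ Ioo 1 (1 + ε / 2) ∧ tailCoord b x ∈ tailCoord b '' A} := by
    rintro _ ⟨x, ⟨hx, hxA⟩, rfl⟩
    have hzero : b.repr (coneToCylinder v x) 0 = ‖x‖ := by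
      rw [b.repr_apply_apply, hb, coneToCylinder]
      simp [inner_add_right, inner_smul_right, inner_sub_right, hv]
    refine ⟨by rwa [hzero], _, hxA, ?_⟩
    ext i
    have hi : inner ℝ (b i.succ) v = (0 : ℝ) := by
      rw [← hb]
      exact b.orthonormal.2 (Fin.succ_ne_zero i)
    simp only [tailCoord, b.repr_apply_apply, coneToCylinder]
    simp [inner_add_right, inner_smul_right, inner_sub_right, hi]
  have key : ENNReal.ofReal (ε / 2) * (m * polarMeasure (k + 1) A) ≤
      ENNReal.ofReal (ε / 2) * μH[(k : ℝ)] A := by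
    calc ENNReal.ofReal (ε / 2) * (m * polarMeasure (k + 1) A)
        = m * (ENNReal.ofReal (ε / 2) * polarMeasure (k + 1) A) := by ring
      _ ≤ m * volume (coneShell A (ε / 2)) := by
        gcongr
        exact mul_polarMeasure_le_volume_coneShell hAm (fun x hx => (hA hx).2) _
      _ ≤ volume (coneToCylinder v '' coneShell A (ε / 2)) := hc _ _ (happrox.mono_set hsub)
      _ ≤ volume (Ioo 1 (1 + ε / 2)) * volume (tailCoord b '' A) := by
        rw [← volume_coord_preimage_prod]
        exact measure_mono himage
      _ ≤ ENNReal.ofReal (ε / 2) * μH[(k : ℝ)] A := by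
        rw [Real.volume_Ioo, add_sub_cancel_left]
        gcongr
        exact volume_tailCoord_image_le b A
  exact (ENNReal.mul_le_mul_iff_right hδ0 ENNReal.ofReal_ne_top).1 key

/-- The surface measure of polar coordinates is dominated by the Hausdorff measure (normalized
so that the unit cube has measure one). -/
theorem polarMeasure_le_hausdorffMeasure (k : ℕ) :
    polarMeasure (k + 1) ≤ (μH[(k : ℝ)]).restrict (sphere 0 1) := by
  have hlocal (m : ℝ≥0) (hm : m < 1) :
      ∃ T : Set (EuclideanSpace ℝ (Fin (k + 1))), MeasurableSet T ∧ sphere 0 1 ⊆ T ∧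
        ∀ A ⊆ T ∩ sphere 0 1, MeasurableSet A →
          m * polarMeasure (k + 1) A ≤ μH[(k : ℝ)] A := by
    refine (isCompact_sphere (0 : EuclideanSpace ℝ (Fin (k + 1))) 1).induction_on
      (p := fun s => ∃ T : Set (EuclideanSpace ℝ (Fin (k + 1))), MeasurableSet T ∧ s ⊆ T ∧
        ∀ A ⊆ T ∩ sphere 0 1, MeasurableSet A →
          m * polarMeasure (k + 1) A ≤ μH[(k : ℝ)] A) ?_ ?_ ?_ ?_
    · refine ⟨∅, .empty, subset_rfl, fun A hA _ => ?_⟩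
      rw [subset_empty_iff.1 (hA.trans inter_subset_left)]
      simp
    · rintro s t hst ⟨T, hT, htT, h⟩
      exact ⟨T, hT, hst.trans htT, h⟩
    · rintro s t ⟨T, hT, hsT, h⟩ ⟨T', hT', htT', h'⟩
      refine ⟨T ∪ T', hT.union hT', union_subset_union hsT htT', fun A hA hAm => ?_⟩
      rw [← measure_inter_add_sdiff A hT, ← measure_inter_add_sdiff A hT, mul_add]
      refine add_le_add (h _ (fun x hx => ⟨hx.2, (hA hx.1).2⟩) (hAm.inter hT))
        (h' _ (fun x hx => ⟨(hA hx.1).1.resolve_left hx.2, (hA hx.1).2⟩) (hAm.diff hT))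
    · intro v hv
      obtain ⟨ε, hε, h⟩ := exists_nhds_mul_polarMeasure_le (by simpa using hv) hm
      exact ⟨ball v ε, mem_nhdsWithin_of_mem_nhds (ball_mem_nhds v hε), ball v ε,
        measurableSet_ball, subset_rfl, h⟩
  refine Measure.le_iff.2 fun A hA => ?_
  have hS : MeasurableSet (sphere (0 : EuclideanSpace ℝ (Fin (k + 1))) 1) :=
    isClosed_sphere.measurableSet
  have hnull : polarMeasure (k + 1) A = polarMeasure (k + 1) (A ∩ sphere 0 1) :=
    (measure_inter_conull (polarMeasure_compl_sphere _)).symm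
  rw [Measure.restrict_apply hA, hnull]
  refine ENNReal.le_of_forall_nnreal_lt fun y hy => ?_
  have hfin : polarMeasure (k + 1) (A ∩ sphere 0 1) ≠ ∞ := measure_ne_top _ _
  lift polarMeasure (k + 1) (A ∩ sphere 0 1) to ℝ≥0 using hfin with a ha
  have hya : y < a := by exact_mod_cast hy
  have ha0 : a ≠ 0 := (pos_of_gt hya).ne'
  obtain ⟨T, -, hST, h⟩ := hlocal (y / a) ((div_lt_one (pos_of_gt hya)).2 hya)
  have := h (A ∩ sphere 0 1) (fun x hx => ⟨hST hx.2, hx.2⟩) (hA.inter hS)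
  rw [← ha, ← ENNReal.coe_mul, div_mul_cancel₀ _ ha0] at this
  exact this

theorem hausdorffMeasure_sphere_lt_top (k : ℕ) :
    μH[(k : ℝ)] (sphere (0 : EuclideanSpace ℝ (Fin (k + 1))) 1) < ∞ := by
  refine (isCompact_sphere _ _).measure_lt_top_of_nhdsWithin fun v hv => ?_
  have hv1 : ‖v‖ = 1 := by simpa using hv
  obtain ⟨b, hb⟩ := exists_orthonormalBasis_zero_eq hv1
  let G : (Fin k → ℝ) → EuclideanSpace ℝ (Fin (k + 1)) := fun x => v + ∑ i, x i • b i.succ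
  let F : (Fin k → ℝ) → EuclideanSpace ℝ (Fin (k + 1)) := fun x => ‖G x‖⁻¹ • G x
  have hG : ContDiff ℝ 1 G := by fun_prop
  have hG0 : G 0 ≠ 0 := by
    simp only [G, Pi.zero_apply, zero_smul, Finset.sum_const_zero, add_zero]
    exact norm_ne_zero_iff.1 (by simp [hv1])
  have hF : ContDiffAt ℝ 1 F 0 :=
    ((hG.contDiffAt.norm ℝ hG0).inv (norm_ne_zero_iff.2 hG0)).smul hG.contDiffAt
  obtain ⟨K, t, ht, hlip⟩ := hF.exists_lipschitzOnWith
  let P : EuclideanSpace ℝ (Fin (k + 1)) → Fin k → ℝ := fun θ i => (b.repr θ 0)⁻¹ * b.repr θ i.succ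
  have hv0 : b.repr v 0 = 1 := by simp [← hb]
  have hPv : P v = 0 := by
    ext i
    simp [P, ← hb]
  have hP : ContinuousAt P v := by
    refine continuousAt_pi.2 fun i => ContinuousAt.mul (ContinuousAt.inv₀ ?_ (by simp [hv0])) ?_
    · fun_prop
    · fun_prop
  have hFP {θ : EuclideanSpace ℝ (Fin (k + 1))} (hθ : ‖θ‖ = 1) (h0 : 0 < b.repr θ 0) :
      F (P θ) = θ := by
    have hGP : G (P θ) = (b.repr θ 0)⁻¹ • θ := by
      have hsum : b.repr θ 0 • v + ∑ i : Fin k, b.repr θ i.succ • b i.succ = θ := by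
        rw [← hb, ← Fin.sum_univ_succ (fun i => b.repr θ i • b i), b.sum_repr]
      calc G (P θ) = (b.repr θ 0)⁻¹ •
            (b.repr θ 0 • v + ∑ i : Fin k, b.repr θ i.succ • b i.succ) := by
            simp only [G, P, smul_add, inv_smul_smul₀ h0.ne', Finset.smul_sum, smul_smul]
        _ = _ := by rw [hsum]
    simp only [F, hGP, norm_smul, hθ, mul_one, norm_inv, Real.norm_of_nonneg h0.le, inv_inv]
    rw [smul_inv_smul₀ h0.ne']
  refine ⟨F '' (t ∩ ball 0 1), ?_, ?_⟩
  · have h1 : ∀ᶠ θ in 𝓝 v, P θ ∈ t ∩ ball 0 1 :=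
      hP.eventually_mem (by rw [hPv]; exact inter_mem ht (ball_mem_nhds 0 one_pos))
    have h2 : ∀ᶠ θ in 𝓝 v, 0 < b.repr θ 0 :=
      (show ContinuousAt (fun θ => b.repr θ 0) v by fun_prop).eventually_mem
        (by rw [hv0]; exact Ioi_mem_nhds one_pos)
    filter_upwards [mem_nhdsWithin_of_mem_nhds h1, mem_nhdsWithin_of_mem_nhds h2,
      self_mem_nhdsWithin] with θ h1 h2 h3
    exact ⟨P θ, h1, hFP (by simpa using h3) h2⟩
  · refine ((hlip.mono inter_subset_left).hausdorffMeasure_image_le k.cast_nonneg).trans_lt ?_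
    rw [hausdorffMeasure_fin]
    exact ENNReal.mul_lt_top (ENNReal.rpow_lt_top_of_nonneg k.cast_nonneg ENNReal.coe_ne_top)
      ((measure_mono inter_subset_right).trans_lt measure_ball_lt_top)

theorem map_add_smul_hausdorffMeasure {k : ℕ} (y₀ : EuclideanSpace ℝ (Fin (k + 1))) {r : ℝ}
    (hr : 0 < r) :
    (μH[(k : ℝ)]).map (fun x => y₀ + r • x) =
      (ENNReal.ofReal (r ^ k))⁻¹ • (μH[(k : ℝ)] : Measure (EuclideanSpace ℝ (Fin (k + 1)))) := by
  have hcomp : (fun x => y₀ + r • x) =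
      IsometryEquiv.addLeft y₀ ∘ AffineMap.homothety (0 : EuclideanSpace ℝ (Fin (k + 1))) r := by
    ext1 x
    simp [AffineMap.homothety_apply]
  rw [hcomp, ← Measure.map_map (IsometryEquiv.addLeft y₀).continuous.measurable
    (AffineMap.homothety_continuous _ _).measurable,
    map_homothety_hausdorffMeasure k.cast_nonneg _ hr.ne', Measure.map_smul,
    IsometryEquiv.map_hausdorffMeasure]
  ext s -
  simp only [Measure.smul_apply, ENNReal.smul_def, smul_eq_mul]
  congr 1
  rw [NNReal.rpow_natCast, ENNReal.coe_pow, ENNReal.coe_inv (by simpa using hr.ne'),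
    ENNReal.ofReal_pow hr.le, ENNReal.inv_pow, Real.nnnorm_of_nonneg hr.le]
  congr 2
  exact (ENNReal.ofReal_eq_coe_nnreal hr.le).symm

theorem setLIntegral_sphere_hausdorffMeasure {k : ℕ} {Q : EuclideanSpace ℝ (Fin (k + 1)) → ℝ≥0∞}
    (hQ : Measurable Q) (y₀ : EuclideanSpace ℝ (Fin (k + 1))) {r : ℝ} (hr : 0 < r) :
    ∫⁻ y in sphere y₀ r, Q y ∂μH[(k : ℝ)] =
      ENNReal.ofReal (r ^ k) * ∫⁻ θ in sphere 0 1, Q (y₀ + r • θ) ∂μH[(k : ℝ)] := by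
  have hpre : (fun x : EuclideanSpace ℝ (Fin (k + 1)) => y₀ + r • x) ⁻¹' sphere y₀ r =
      sphere 0 1 := by
    ext x
    simp [norm_smul, abs_of_pos hr, hr.ne']
  have h := setLIntegral_map (μ := (μH[(k : ℝ)] : Measure (EuclideanSpace ℝ (Fin (k + 1)))))
    (isClosed_sphere (x := y₀) (ε := r)).measurableSet hQ
    (show Measurable fun x => y₀ + r • x by fun_prop)
  rw [map_add_smul_hausdorffMeasure y₀ hr, Measure.restrict_smul, lintegral_smul_measure,
    hpre] at h
  rw [← h, smul_eq_mul, ← mul_assoc, ENNReal.mul_inv_cancel, one_mul]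
  · simpa using pow_pos hr k
  · exact ENNReal.ofReal_ne_top

theorem lintegral_annulus_le {k : ℕ} {Q : EuclideanSpace ℝ (Fin (k + 1)) → ℝ≥0∞}
    (hQ : Measurable Q) {η : ℝ → ℝ≥0∞} (hη : Measurable η)
    (y₀ : EuclideanSpace ℝ (Fin (k + 1))) (r₁ r₂ : ℝ) :
    ∫⁻ y in annulus (k + 1) y₀ r₁ r₂, Q y * η (dist y y₀) ^ (k + 1) ≤
      ∫⁻ r in Ioo r₁ r₂, ENNReal.ofReal (r ^ k) *
        (η r ^ (k + 1) * ∫⁻ θ in sphere 0 1, Q (y₀ + r • θ) ∂μH[(k : ℝ)]) := by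
  have hA : MeasurableSet (annulus (k + 1) y₀ r₁ r₂) :=
    (measurable_id.dist measurable_const : Measurable
      fun y : EuclideanSpace ℝ (Fin (k + 1)) => dist y y₀) measurableSet_Ioo
  set F : EuclideanSpace ℝ (Fin (k + 1)) → ℝ≥0∞ :=
    (annulus (k + 1) y₀ r₁ r₂).indicator fun y => Q y * η (dist y y₀) ^ (k + 1) with hF
  have hFm : Measurable F := by
    refine Measurable.indicator ?_ hA
    exact hQ.mul ((hη.comp (measurable_id.dist measurable_const)).pow_const _)
  have hFval {r : ℝ} (hr : 0 < r) {θ : EuclideanSpace ℝ (Fin (k + 1))} (hθ : θ ∈ sphere 0 1) :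
      F (y₀ + r • θ) = (Ioo r₁ r₂).indicator (fun r => η r ^ (k + 1) * Q (y₀ + r • θ)) r := by
    have hd : dist (y₀ + r • θ) y₀ = r := by
      have : ‖θ‖ = 1 := by simpa using hθ
      simp [norm_smul, this, abs_of_pos hr]
    by_cases h : r ∈ Ioo r₁ r₂
    · have : y₀ + r • θ ∈ annulus (k + 1) y₀ r₁ r₂ := by
        simpa only [annulus, mem_ofPred_eq, hd, mem_Ioo] using h
      rw [hF, indicator_of_mem this, indicator_of_mem h, hd, mul_comm]
    · have : y₀ + r • θ ∉ annulus (k + 1) y₀ r₁ r₂ := by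
        simpa only [annulus, mem_ofPred_eq, hd, mem_Ioo] using h
      rw [hF, indicator_of_notMem this, indicator_of_notMem h]
  rw [← lintegral_indicator hA, ← lintegral_add_left_eq_self F y₀,
    lintegral_polar (F := fun x => F (y₀ + x)) (hFm.comp (measurable_const_add y₀))]
  calc ∫⁻ r in Ioi (0 : ℝ), ENNReal.ofReal (r ^ k) *
        ∫⁻ θ, F (y₀ + r • θ) ∂polarMeasure (k + 1)
      ≤ ∫⁻ r in Ioi (0 : ℝ), (Ioo r₁ r₂).indicator (fun r => ENNReal.ofReal (r ^ k) *
          (η r ^ (k + 1) * ∫⁻ θ in sphere 0 1, Q (y₀ + r • θ) ∂μH[(k : ℝ)])) r := by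
        refine setLIntegral_mono' measurableSet_Ioi fun r hr => ?_
        have hle : ∫⁻ θ, F (y₀ + r • θ) ∂polarMeasure (k + 1) ≤
            ∫⁻ θ in sphere 0 1, F (y₀ + r • θ) ∂μH[(k : ℝ)] :=
          lintegral_mono' (polarMeasure_le_hausdorffMeasure k) le_rfl
        rw [setLIntegral_congr_fun isClosed_sphere.measurableSet fun θ hθ => hFval hr hθ] at hle
        by_cases h : r ∈ Ioo r₁ r₂
        · simp only [indicator_of_mem h] at hle ⊢
          rw [lintegral_const_mul _ (by fun_prop)] at hle
          gcongr
        · simp only [indicator_of_notMem h, lintegral_zero] at hle ⊢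
          rw [nonpos_iff_eq_zero.1 hle, mul_zero]
    _ ≤ _ := by
        rw [setLIntegral_indicator measurableSet_Ioo]
        exact lintegral_mono_set inter_subset_left

theorem sphereArea_succ (k : ℕ) :
    sphereArea (k + 1) = μH[(k : ℝ)] (sphere (0 : EuclideanSpace ℝ (Fin (k + 1))) 1) := by
  simp [sphereArea]

theorem sphereArea_succ_ne_top (k : ℕ) : sphereArea (k + 1) ≠ ∞ := by
  rw [sphereArea_succ]
  exact (hausdorffMeasure_sphere_lt_top k).ne

theorem sphereArea_succ_ne_zero (k : ℕ) : sphereArea (k + 1) ≠ 0 := by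
  rw [sphereArea_succ]
  have h := polarMeasure_le_hausdorffMeasure k univ
  rw [Measure.restrict_apply_univ] at h
  exact (h.trans_lt' (pos_iff_ne_zero.2 (polarMeasure_univ_ne_zero k))).ne'

theorem sphereAvg_eq {k : ℕ} {Q : EuclideanSpace ℝ (Fin (k + 1)) → ℝ≥0∞}
    (hQ : Measurable Q) (y₀ : EuclideanSpace ℝ (Fin (k + 1))) {r : ℝ} (hr : 0 < r) :
    sphereAvg (k + 1) Q y₀ r =
      (∫⁻ θ in sphere 0 1, Q (y₀ + r • θ) ∂μH[(k : ℝ)]) / sphereArea (k + 1) := by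
  have h0 : ENNReal.ofReal (r ^ k) ≠ 0 := by simpa using pow_pos hr k
  have hcast : ((k + 1 : ℕ) : ℝ) - 1 = k := by simp
  rw [sphereAvg, hcast, setLIntegral_sphere_hausdorffMeasure hQ y₀ hr, Nat.add_sub_cancel,
    mul_comm (sphereArea (k + 1)), ENNReal.mul_div_mul_left _ _ h0 ENNReal.ofReal_ne_top]

theorem measurable_sphere_integral {k : ℕ} {Q : EuclideanSpace ℝ (Fin (k + 1)) → ℝ≥0∞}
    (hQ : Measurable Q) (y₀ : EuclideanSpace ℝ (Fin (k + 1))) :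
    Measurable fun r : ℝ => ∫⁻ θ in sphere 0 1, Q (y₀ + r • θ) ∂μH[(k : ℝ)] := by
  have : IsFiniteMeasure ((μH[(k : ℝ)] : Measure (EuclideanSpace ℝ (Fin (k + 1)))).restrict
      (sphere 0 1)) := ⟨by
    rw [Measure.restrict_apply_univ]
    exact hausdorffMeasure_sphere_lt_top k⟩
  refine Measurable.lintegral_prod_right' (f := fun p : ℝ × EuclideanSpace ℝ (Fin (k + 1)) =>
    Q (y₀ + p.1 • p.2)) ?_
  fun_prop

theorem ENNReal.pow_mul_inv_mul_pow_succ_le {k : ℕ} (I : ℝ≥0∞) {w : ℝ≥0∞} (hw : w ≠ 0) :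
    w ^ k * (I⁻¹ * w⁻¹) ^ (k + 1) ≤ I⁻¹ ^ (k + 1) * w⁻¹ := by
  rcases eq_or_ne w ∞ with rfl | hw'
  · simp
  · rw [mul_pow, pow_succ w⁻¹]
    calc w ^ k * (I⁻¹ ^ (k + 1) * (w⁻¹ ^ k * w⁻¹))
        = I⁻¹ ^ (k + 1) * ((w * w⁻¹) ^ k * w⁻¹) := by ring
      _ ≤ _ := by rw [ENNReal.mul_inv_cancel hw hw', one_pow, one_mul]

/-- **The key modulus estimate `M(Γ_f(y₀,r₁,r₂)) ≤ ω_{n−1}/I^{n−1}`.** -/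
theorem modulus_le_of_invPoletsky
    (n : ℕ) (hn : 2 ≤ n)
    (D : Set (EuclideanSpace ℝ (Fin n))) (hD : IsOpen D) (hDconn : IsConnected D)
    (Q : EuclideanSpace ℝ (Fin n) → ℝ≥0∞) (hQmeas : Measurable Q)
    (f : EuclideanSpace ℝ (Fin n) → EuclideanSpace ℝ (Fin n))
    (y₀ : EuclideanSpace ℝ (Fin n)) (r₀ : ℝ) (hr₀ : 0 < r₀)
    -- `f` satisfies the inverse Poletsky inequality at `y₀` with majorant `Q`, radius `r₀`
    (hf : ∀ r₁ r₂ : ℝ, 0 < r₁ → r₁ < r₂ → r₂ < r₀ →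
      ∀ η : ℝ → ℝ≥0∞, Measurable η → 1 ≤ ∫⁻ r in Set.Ioo r₁ r₂, η r →
        modulus n (liftedFamily n D f y₀ r₁ r₂) ≤
          ∫⁻ y in (f '' D) ∩ annulus n y₀ r₁ r₂, Q y * η (dist y y₀) ^ n)
    (r₁ r₂ : ℝ) (h1 : 0 < r₁) (h12 : r₁ < r₂) (h2 : r₂ < r₀)
    (hE : ∃ E ⊆ Set.Icc r₁ r₂, 0 < volume E ∧
      ∀ r ∈ E, (∫⁻ y in Metric.sphere y₀ r, Q y ∂(μH[(n : ℝ) - 1])) < ∞) :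
    0 < Ifun n (fun y => max (Q y) 1) y₀ r₁ r₂ ∧
    Ifun n (fun y => max (Q y) 1) y₀ r₁ r₂ < ∞ ∧
    modulus n (liftedFamily n D f y₀ r₁ r₂) ≤
      sphereArea n / Ifun n (fun y => max (Q y) 1) y₀ r₁ r₂ ^ (n - 1) := by
  obtain ⟨k, rfl⟩ : ∃ k, n = k + 1 := ⟨n - 1, by omega⟩
  have hk : k ≠ 0 := by omega
  have hcast : ((k + 1 : ℕ) : ℝ) - 1 = k := by simp
  set R : EuclideanSpace ℝ (Fin (k + 1)) → ℝ≥0∞ := fun y => max (Q y) 1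
  have hR : Measurable R := hQmeas.max measurable_const
  let J : ℝ → ℝ≥0∞ := fun r => ∫⁻ θ in sphere 0 1, R (y₀ + r • θ) ∂μH[(k : ℝ)]
  have hJ : Measurable J := measurable_sphere_integral hR y₀
  have hω0 := sphereArea_succ_ne_zero k
  have hωtop := sphereArea_succ_ne_top k
  set ω := sphereArea (k + 1) with hω
  let w : ℝ → ℝ≥0∞ := fun r => ENNReal.ofReal r * (J r / ω) ^ (k : ℝ)⁻¹
  have hw : Measurable w :=
    ENNReal.measurable_ofReal.mul ((hJ.div_const ω).pow_const _)
  have hI : Ifun (k + 1) R y₀ r₁ r₂ = ∫⁻ r in Ioo r₁ r₂, (w r)⁻¹ := by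
    refine setLIntegral_congr_fun measurableSet_Ioo fun r hr => ?_
    simp only [w, J, hω, ← sphereAvg_eq hR y₀ (h1.trans hr.1), hcast, one_div]
  rw [hI]
  set I := ∫⁻ r in Ioo r₁ r₂, (w r)⁻¹
  have hJω (r : ℝ) : ω ≤ J r := by
    rw [hω, sphereArea_succ, ← setLIntegral_one]
    exact lintegral_mono fun θ => le_max_right _ _
  have hw_ge (r : ℝ) : ENNReal.ofReal r ≤ w r := by
    refine le_mul_of_one_le_right' (ENNReal.one_le_rpow ?_ (by positivity))
    rw [ENNReal.le_div_iff_mul_le (.inl hω0) (.inl hωtop), one_mul]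
    exact hJω r
  have hw0 {r : ℝ} (hr : 0 < r) : w r ≠ 0 :=
    ((ENNReal.ofReal_pos.2 hr).trans_le (hw_ge r)).ne'
  have hw_pow {r : ℝ} (hr : 0 < r) : ENNReal.ofReal (r ^ k) * J r = ω * w r ^ k := by
    rw [mul_pow, ENNReal.rpow_inv_natCast_pow hk, ← ENNReal.ofReal_pow hr.le, mul_left_comm,
      ENNReal.mul_div_cancel hω0 hωtop]
  have hItop : I < ∞ := by
    calc I ≤ ∫⁻ _ in Ioo r₁ r₂, (ENNReal.ofReal r₁)⁻¹ :=
          setLIntegral_mono' measurableSet_Ioo fun r hr => ENNReal.inv_le_inv.2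
            ((ENNReal.ofReal_le_ofReal hr.1.le).trans (hw_ge r))
      _ < ∞ := by
          rw [setLIntegral_const, Real.volume_Ioo]
          exact ENNReal.mul_lt_top (by simpa using h1) ENNReal.ofReal_lt_top
  have hIpos : 0 < I := by
    obtain ⟨E, hEsub, hEpos, hEfin⟩ := hE
    refine (setLIntegral_pos_iff (f := fun r => (w r)⁻¹) hw.inv).2 ?_
    have hsub : E ⊆ (Function.support (fun r => (w r)⁻¹) ∩ Ioo r₁ r₂) ∪ {r₁, r₂} := by
      intro r hr
      rcases (hEsub hr).1.eq_or_lt with rfl | hr1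
      · simp
      rcases (hEsub hr).2.eq_or_lt with rfl | hr2
      · simp
      refine .inl ⟨?_, hr1, hr2⟩
      have hr0 := h1.trans hr1
      have hk0 : ENNReal.ofReal (r ^ k) ≠ 0 := by simpa using pow_pos hr0 k
      have hQfin := hEfin r hr
      rw [hcast, setLIntegral_sphere_hausdorffMeasure hQmeas y₀ hr0] at hQfin
      have hJfin : J r < ∞ := by
        calc J r ≤ ∫⁻ θ in sphere 0 1, (Q (y₀ + r • θ) + 1) ∂μH[(k : ℝ)] :=
              lintegral_mono fun θ => max_le_add_of_nonneg zero_le zero_le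
          _ = (∫⁻ θ in sphere 0 1, Q (y₀ + r • θ) ∂μH[(k : ℝ)]) + ω := by
              rw [lintegral_add_right _ measurable_const, setLIntegral_one, hω, sphereArea_succ]
          _ < ∞ := ENNReal.add_lt_top.2
              ⟨ENNReal.lt_top_of_mul_ne_top_right hQfin.ne hk0, hωtop.lt_top⟩
      exact ENNReal.inv_ne_zero.2 (ENNReal.mul_lt_top ENNReal.ofReal_lt_top
        (ENNReal.rpow_lt_top_of_nonneg (by positivity)
          (ENNReal.div_lt_top hJfin.ne hω0).ne)).ne
    refine hEpos.trans_le ((measure_mono hsub).trans ((measure_union_le _ _).trans ?_))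
    rw [(Set.toFinite {r₁, r₂}).measure_zero, add_zero]
  refine ⟨hIpos, hItop, ?_⟩
  let η : ℝ → ℝ≥0∞ := fun r => I⁻¹ * (w r)⁻¹
  have hη : Measurable η := hw.inv.const_mul _
  have hη1 : 1 ≤ ∫⁻ r in Ioo r₁ r₂, η r := by
    have h : ∫⁻ r in Ioo r₁ r₂, η r = I⁻¹ * I := lintegral_const_mul _ hw.inv
    rw [h, ENNReal.inv_mul_cancel hIpos.ne' hItop.ne]
  calc modulus (k + 1) (liftedFamily (k + 1) D f y₀ r₁ r₂)
      ≤ ∫⁻ y in (f '' D) ∩ annulus (k + 1) y₀ r₁ r₂, Q y * η (dist y y₀) ^ (k + 1) :=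
        hf r₁ r₂ h1 h12 h2 η hη hη1
    _ ≤ ∫⁻ y in annulus (k + 1) y₀ r₁ r₂, Q y * η (dist y y₀) ^ (k + 1) :=
        lintegral_mono_set inter_subset_right
    _ ≤ ∫⁻ y in annulus (k + 1) y₀ r₁ r₂, R y * η (dist y y₀) ^ (k + 1) :=
        lintegral_mono fun y => mul_le_mul' (le_max_left _ _) le_rfl
    _ ≤ ∫⁻ r in Ioo r₁ r₂, ENNReal.ofReal (r ^ k) * (η r ^ (k + 1) * J r) :=
        lintegral_annulus_le hR hη y₀ r₁ r₂
    _ ≤ ∫⁻ r in Ioo r₁ r₂, ω * I⁻¹ ^ (k + 1) * (w r)⁻¹ := by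
        refine setLIntegral_mono' measurableSet_Ioo fun r hr => ?_
        have hr0 := h1.trans hr.1
        calc ENNReal.ofReal (r ^ k) * (η r ^ (k + 1) * J r)
            = ω * (w r ^ k * (I⁻¹ * (w r)⁻¹) ^ (k + 1)) := by
              rw [mul_left_comm, hw_pow hr0, mul_comm, mul_assoc]
          _ ≤ ω * (I⁻¹ ^ (k + 1) * (w r)⁻¹) :=
              mul_le_mul' le_rfl (ENNReal.pow_mul_inv_mul_pow_succ_le I (hw0 hr0))
          _ = ω * I⁻¹ ^ (k + 1) * (w r)⁻¹ := (mul_assoc _ _ _).symm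
    _ = ω * I⁻¹ ^ (k + 1) * I := lintegral_const_mul _ hw.inv
    _ = ω / I ^ (k + 1 - 1) := by
        rw [pow_succ, mul_assoc, mul_assoc, ENNReal.inv_mul_cancel hIpos.ne' hItop.ne, mul_one,
          Nat.add_sub_cancel, div_eq_mul_inv, ENNReal.inv_pow]

end
end
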